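/- arXiv:2411.05250 — 3 statements merged into one kernel-verified Lean document; each statement's English description precedes it below -/
import Mathlib

section
/- Let R be a ring and f : X → Y a morphism of chain complexes of left R-modules. Then f induces the zero map on all homology groups (Hₙ(f) = 0 for all n ∈ ℤ) if and only if for every n ∈ ℤ, the induced map Ext¹(Sⁿ(R), f) : Ext¹(Sⁿ(R), X) → Ext¹(Sⁿ(R), Y) in the category of chain complexes is zero, where Sⁿ(R) is the sphere complex with R concentrated in degree n. -/
open CategoryTheory Limits CategoryTheory.Abelian

universe w u

namespace Ghost

open HomologicalComplex

variable {C : Type*} [Category* C] [Abelian C]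

lemma rel (n : ℤ) : (ComplexShape.down ℤ).Rel n (n - 1) := by simp

lemma ne (n : ℤ) : n ≠ n - 1 := by omega

/-- The inclusion of the sphere in the disk. -/
noncomputable def incl (P : C) (n : ℤ) :
    (single C (ComplexShape.down ℤ) (n - 1)).obj P ⟶ double (𝟙 P) (rel n) :=
  mkHomFromSingle (doubleXIso₁ (𝟙 P) (rel n) (ne n)).inv (fun k _ => by
    rw [double_d_eq_zero₀ _ _ _ _ (ne n).symm, comp_zero])

/-- The projection of the disk on the sphere. -/
noncomputable def proj (P : C) (n : ℤ) :
    double (𝟙 P) (rel n) ⟶ (single C (ComplexShape.down ℤ) n).obj P :=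
  mkHomToSingle (doubleXIso₀ (𝟙 P) (rel n)).hom (fun k _ => by
    rw [double_d_eq_zero₁ _ _ _ _ (ne n), zero_comp])

lemma incl_proj (P : C) (n : ℤ) : incl P n ≫ proj P n = 0 := by
  apply from_single_hom_ext
  exact (isZero_single_obj_X _ n P (n - 1) (ne n).symm).eq_of_tgt _ _

/-- The short complex sphere, disk, sphere. -/
noncomputable def sc (P : C) (n : ℤ) : ShortComplex (ChainComplex C ℤ) :=
  ShortComplex.mk (incl P n) (proj P n) (incl_proj P n)

lemma sc_shortExact (P : C) (n : ℤ) : (sc P n).ShortExact := by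
  apply shortExact_of_degreewise_shortExact
  intro i
  by_cases h₀ : i = n
  · subst h₀
    have z : IsZero ((sc P i).map (eval C (ComplexShape.down ℤ) i)).X₁ :=
      isZero_single_obj_X (ComplexShape.down ℤ) (i - 1) P i (ne i)
    have : IsIso ((sc P i).map (eval C (ComplexShape.down ℤ) i)).g := by
      change IsIso ((proj P i).f i)
      rw [proj, mkHomToSingle_f]
      infer_instance
    have hf : ((sc P i).map (eval C (ComplexShape.down ℤ) i)).f = 0 := z.eq_of_src _ _
    exact { exact := (ShortComplex.exact_iff_mono _ hf).2 inferInstance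
            mono_f := ⟨fun _ _ _ => z.eq_of_tgt _ _⟩
            epi_g := inferInstance }
  · have z : IsZero ((sc P n).map (eval C (ComplexShape.down ℤ) i)).X₃ :=
      isZero_single_obj_X (ComplexShape.down ℤ) n P i h₀
    have hg : ((sc P n).map (eval C (ComplexShape.down ℤ) i)).g = 0 := z.eq_of_tgt _ _
    have : IsIso ((sc P n).map (eval C (ComplexShape.down ℤ) i)).f := by
      change IsIso ((incl P n).f i)
      by_cases h₁ : i = n - 1
      · subst h₁
        rw [incl, mkHomFromSingle_f]
        infer_instance
      · exact isIso_of_source_target_iso_zero _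
          (isZero_single_obj_X _ (n - 1) P i h₁).isoZero
          (isZero_double_X _ _ i h₀ h₁).isoZero
    exact { exact := (ShortComplex.exact_iff_epi _ hg).2 inferInstance
            mono_f := inferInstance
            epi_g := ⟨fun _ _ _ => z.eq_of_src _ _⟩ }

lemma projective_disk (P : C) [Projective P] (n : ℤ) :
    Projective (double (𝟙 P) (rel n) : ChainComplex C ℤ) where
  factors {E X} f e _ := by
    have : Epi (e.f n) := inferInstanceAs (Epi ((eval C (ComplexShape.down ℤ) n).map e))
    let φ : P ⟶ E.X n := Projective.factorThru ((doubleXIso₀ _ (rel n)).inv ≫ f.f n) (e.f n)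
    have hφ : φ ≫ e.f n = (doubleXIso₀ _ (rel n)).inv ≫ f.f n := Projective.factorThru_comp _ _
    refine ⟨mkHomFromDouble (rel n) (ne n) φ (φ ≫ E.d n (n - 1)) (by simp) (by simp), ?_⟩
    apply from_double_hom_ext
    · simp [hφ]
    · simp only [comp_f, mkHomFromDouble_f₁, Category.assoc]
      rw [← e.comm, reassoc_of% hφ, f.comm, double_d _ _ (ne n)]
      simp

lemma ext_iff_aux {A : Type*} [Category* A] [Abelian A] [HasExt.{w} A] {S : ShortComplex A}
    (hS : S.ShortExact) [Projective S.X₂] {X Y : A} (f : X ⟶ Y) :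
    (∀ e : Ext S.X₃ X 1, e.comp (Ext.mk₀ f) (add_zero 1) = 0) ↔
    ∀ g : S.X₁ ⟶ X, ∃ h : S.X₂ ⟶ Y, S.f ≫ h = g ≫ f := by
  constructor
  · intro H g
    have h1 := H (hS.extClass.comp (Ext.mk₀ g) (add_zero 1))
    rw [Ext.comp_assoc_of_third_deg_zero, Ext.mk₀_comp_mk₀] at h1
    obtain ⟨x, hx⟩ := Ext.contravariant_sequence_exact₁ hS Y _ _ h1
    obtain ⟨h, rfl⟩ := Ext.mk₀_bijective _ _ |>.2 x
    rw [Ext.mk₀_comp_mk₀] at hx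
    exact ⟨h, (Ext.mk₀_bijective _ _).1 hx⟩
  · intro H e
    obtain ⟨x, hx⟩ := Ext.contravariant_sequence_exact₃ hS X e
      (Ext.eq_zero_of_projective _) (n₀ := 0) rfl
    obtain ⟨g, rfl⟩ := Ext.mk₀_bijective _ _ |>.2 x
    obtain ⟨h, hh⟩ := H g
    rw [← hx, Ext.comp_assoc_of_third_deg_zero, Ext.mk₀_comp_mk₀, ← hh, ← Ext.mk₀_comp_mk₀]
    exact hS.extClass_comp_assoc _

lemma ext_iff [HasExt.{w} (ChainComplex C ℤ)] (P : C) [Projective P] {X Y : ChainComplex C ℤ}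
    (f : X ⟶ Y) (n : ℤ) :
    (∀ e : Ext ((single C (ComplexShape.down ℤ) n).obj P) X 1,
        e.comp (Ext.mk₀ f) (add_zero 1) = 0) ↔
    ∀ g : (single C (ComplexShape.down ℤ) (n - 1)).obj P ⟶ X,
      ∃ h : (double (𝟙 P) (rel n) : ChainComplex C ℤ) ⟶ Y, incl P n ≫ h = g ≫ f := by
  have : Projective (sc P n).X₂ := projective_disk P n
  exact ext_iff_aux (sc_shortExact P n) f

lemma lift_iff (P : C) {X Y : ChainComplex C ℤ} (f : X ⟶ Y) (n : ℤ) :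
    (∀ g : (single C (ComplexShape.down ℤ) (n - 1)).obj P ⟶ X,
      ∃ h : (double (𝟙 P) (rel n) : ChainComplex C ℤ) ⟶ Y, incl P n ≫ h = g ≫ f) ↔
    ∀ z : P ⟶ X.X (n - 1), z ≫ X.d (n - 1) (n - 1 - 1) = 0 →
      ∃ y : P ⟶ Y.X n, z ≫ f.f (n - 1) = y ≫ Y.d n (n - 1) := by
  constructor
  · intro H z hz
    obtain ⟨h, hh⟩ := H (mkHomFromSingle z (fun k hk => by
      obtain rfl : k = n - 1 - 1 := by simp at hk; omega
      exact hz))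
    refine ⟨(doubleXIso₀ _ (rel n)).inv ≫ h.f n, ?_⟩
    have := congr_arg (fun φ => Hom.f φ (n - 1)) hh
    simp only [incl, comp_f, mkHomFromSingle_f, Category.assoc, Iso.cancel_iso_hom_left] at this
    rw [← this, Category.assoc, h.comm, double_d _ _ (ne n)]
    simp
  · intro H g
    obtain ⟨y, hy⟩ := H ((singleObjXSelf _ _ _).inv ≫ g.f (n - 1)) (by simp)
    refine ⟨mkHomFromDouble (rel n) (ne n) y (y ≫ Y.d n (n - 1)) (by simp) (by simp), ?_⟩
    apply from_single_hom_ext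
    simp [incl, ← hy]

lemma homologyMap_iff (P : C) [Projective P] (hP : IsSeparator P)
    {X Y : ChainComplex C ℤ} (f : X ⟶ Y) (n : ℤ) :
    homologyMap f (n - 1) = 0 ↔
    ∀ z : P ⟶ X.X (n - 1), z ≫ X.d (n - 1) (n - 1 - 1) = 0 →
      ∃ y : P ⟶ Y.X n, z ≫ f.f (n - 1) = y ≫ Y.d n (n - 1) := by
  have hprev : (ComplexShape.down ℤ).prev (n - 1) = n :=
    ComplexShape.prev_eq' _ (rel n)
  have hnext : (ComplexShape.down ℤ).next (n - 1) = n - 1 - 1 :=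
    ComplexShape.next_eq' _ (rel (n - 1))
  have key (z : P ⟶ X.X (n - 1)) (hz : z ≫ X.d (n - 1) (n - 1 - 1) = 0) :
      X.liftCycles z _ hnext hz ≫ X.homologyπ _ ≫ homologyMap f (n - 1) = 0 ↔
        ∃ y : P ⟶ Y.X n, z ≫ f.f (n - 1) = y ≫ Y.d n (n - 1) := by
    rw [homologyπ_naturality, liftCycles_comp_cyclesMap_assoc,
      liftCycles_comp_homologyπ_eq_zero_iff_up_to_refinements _ n _ _ hprev]
    constructor
    · rintro ⟨A', π, _, x, hx⟩
      refine ⟨Projective.factorThru (𝟙 P) π ≫ x, ?_⟩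
      rw [Category.assoc, ← hx, Projective.factorThru_comp_assoc, Category.id_comp]
    · rintro ⟨y, hy⟩
      exact ⟨P, 𝟙 P, inferInstance, y, by rw [Category.id_comp, hy]⟩
  constructor
  · intro H z hz
    rw [← key z hz, H, comp_zero, comp_zero]
  · intro H
    rw [← cancel_epi (X.homologyπ _), comp_zero]
    apply hP.def
    intro z
    have hz : (z ≫ X.iCycles _) ≫ X.d (n - 1) (n - 1 - 1) = 0 := by simp
    have := (key _ hz).2 (H _ hz)
    rw [comp_zero, ← this]
    congr 1
    simp [← cancel_mono (X.iCycles _)]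

end Ghost

/-- A morphism `f : X ⟶ Y` of chain complexes of left `R`-modules induces the zero map on
all homology groups if and only if for every `n : ℤ` the induced map
`Ext¹(Sⁿ(R), f) : Ext¹(Sⁿ(R), X) → Ext¹(Sⁿ(R), Y)` in the category of chain complexes is
zero, where `Sⁿ(R)` is the sphere complex with `R` concentrated in degree `n`. -/
theorem stmt10 {R : Type u} [Ring R]
    [HasExt.{w} (ChainComplex (ModuleCat.{u} R) ℤ)]
    (X Y : ChainComplex (ModuleCat.{u} R) ℤ) (f : X ⟶ Y) :
    (∀ n : ℤ, HomologicalComplex.homologyMap f n = 0) ↔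
      (∀ n : ℤ, ∀ e : Ext ((HomologicalComplex.single (ModuleCat.{u} R)
            (ComplexShape.down ℤ) n).obj (ModuleCat.of R R)) X 1,
        e.comp (Ext.mk₀ f) (add_zero 1) = 0) := by
  have : Projective (ModuleCat.of R R) :=
    (IsProjective.iff_projective R).1 inferInstance
  have hP : IsSeparator (ModuleCat.of R R) := by
    rw [isSeparator_def]
    intro M N g₁ g₂ h
    ext x
    have := congr_arg (fun φ => φ.hom 1) (h (ModuleCat.ofHom (LinearMap.toSpanSingleton R M x)))
    simpa using this
  have key (n : ℤ) := (Ghost.homologyMap_iff (ModuleCat.of R R) hP f n).trans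
    ((Ghost.lift_iff _ f n).symm.trans (Ghost.ext_iff (ModuleCat.of R R) f n).symm)
  constructor
  · intro H n
    exact (key n).1 (H _)
  · intro H n
    obtain ⟨m, rfl⟩ : ∃ m, n = m - 1 := ⟨n + 1, by simp⟩
    exact (key m).2 (H m)
end

section
/- Let R be a ring such that the class of pure projective left R-modules is closed under extensions: whenever 0 → A → B → C → 0 is a short exact sequence of left R-modules with A and C pure projective, B is pure projective. Then every FP-projective left R-module is pure projective, where a module N is FP-projective if Ext¹(N, M) = 0 for every FP-injective module M. -/
open CategoryTheory Limits CategoryTheory.Abelian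

universe w u

namespace Stmt16

variable {R : Type u} [Ring R]

/-- A left `R`-module is pure projective if it is a direct summand of a direct sum of
finitely presented modules. -/
def IsPureProjective (P : ModuleCat.{u} R) : Prop :=
  ∃ (ι : Type u) (M : ι → ModuleCat.{u} R),
    (∀ i, Module.FinitePresentation R (M i)) ∧
    ∃ (s : P ⟶ ∐ M) (r : (∐ M) ⟶ P), s ≫ r = 𝟙 P

variable [HasExt.{w} (ModuleCat.{u} R)]

/-- A left `R`-module `M` is FP-injective if `Ext¹(S, M) = 0` for every finitely
presented module `S`. -/
def IsFPInjective (M : ModuleCat.{u} R) : Prop :=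
  ∀ S : ModuleCat.{u} R, Module.FinitePresentation R S → Subsingleton (Ext.{w} S M 1)

/-- A left `R`-module `N` is FP-projective if `Ext¹(N, M) = 0` for every FP-injective
module `M`. -/
def IsFPProjective (N : ModuleCat.{u} R) : Prop :=
  ∀ M : ModuleCat.{u} R, IsFPInjective.{w} M → Subsingleton (Ext.{w} N M 1)

end Stmt16


set_option linter.unusedSectionVars false

namespace Stmt16P
variable {R : Type u} [Ring R]

/-- Maps from finitely presented modules lift along `q`. -/
def PureEpi {B D : Type u} [AddCommGroup B] [Module R B] [AddCommGroup D] [Module R D]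
    (q : B →ₗ[R] D) : Prop :=
  ∀ (S : Type u) [AddCommGroup S] [Module R S] [Module.FinitePresentation R S] (g : S →ₗ[R] D),
    ∃ h : S →ₗ[R] B, q ∘ₗ h = g

variable (R) in
/-- Lifting property against pure epimorphisms. -/
def LP (P : Type u) [AddCommGroup P] [Module R P] : Prop :=
  ∀ (B D : Type u) [AddCommGroup B] [Module R B] [AddCommGroup D] [Module R D]
    (q : B →ₗ[R] D), PureEpi q → ∀ g : P →ₗ[R] D, ∃ h : P →ₗ[R] B, q ∘ₗ h = g

variable (R) in
/-- Index type of the canonical cover. -/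
def CI (D : Type u) [AddCommGroup D] [Module R D] : Type u :=
  Σ k : ℕ, Σ L : {L : Submodule R (Fin k → R) // L.FG}, ((Fin k → R) ⧸ L.1) →ₗ[R] D

/-- Members of the canonical cover. -/
abbrev CS {D : Type u} [AddCommGroup D] [Module R D] (i : CI R D) : Type u :=
  (Fin i.1 → R) ⧸ i.2.1.1

variable (R) in
/-- The canonical cover. -/
abbrev Cov (D : Type u) [AddCommGroup D] [Module R D] : Type u :=
  Π₀ i : CI R D, CS i

instance {D : Type u} [AddCommGroup D] [Module R D] (i : CI R D) :
    Module.FinitePresentation R (CS i) :=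
  Module.finitePresentation_of_surjective i.2.1.1.mkQ (Submodule.mkQ_surjective _)
    (by rw [Submodule.ker_mkQ]; exact i.2.1.2)

open Classical in
variable (R) in
/-- The canonical pure epimorphism. -/
noncomputable def covMap (D : Type u) [AddCommGroup D] [Module R D] : Cov R D →ₗ[R] D :=
  DFinsupp.lsum ℕ (fun i => i.2.2)

theorem exists_fin_pres (S : Type u) [AddCommGroup S] [Module R S]
    [Module.FinitePresentation R S] :
    ∃ (k : ℕ) (L : Submodule R (Fin k → R)), L.FG ∧ Nonempty (S ≃ₗ[R] ((Fin k → R) ⧸ L)) := by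
  obtain ⟨k, L, e, hL⟩ := Module.FinitePresentation.exists_fin (R := R) (M := S)
  exact ⟨k, L, hL, ⟨e⟩⟩

theorem covMap_pure (D : Type u) [AddCommGroup D] [Module R D] :
    PureEpi (B := Cov R D) (covMap R D) := by
  classical
  intro S _ _ _ g
  obtain ⟨k, L, hL, ⟨e⟩⟩ := exists_fin_pres (R := R) S
  let i : CI R D := ⟨k, ⟨L, hL⟩, g ∘ₗ e.symm.toLinearMap⟩
  refine ⟨DFinsupp.lsingle (M := fun i : CI R D => CS i) i ∘ₗ e.toLinearMap, ?_⟩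
  ext x
  have := DFinsupp.lsum_single (R := R) ℕ (M := fun i : CI R D => CS i)
    (fun i : CI R D => i.2.2) i (e x)
  rw [LinearMap.comp_apply, LinearMap.comp_apply]
  refine this.trans ?_
  simp [i]

theorem LP_fp (S : Type u) [AddCommGroup S] [Module R S] [Module.FinitePresentation R S] :
    LP R S := fun _ _ _ _ _ _ _ hq g => hq S g

theorem LP_directSum {ι : Type u} (S : ι → Type u) [∀ i, AddCommGroup (S i)]
    [∀ i, Module R (S i)] (h : ∀ i, LP R (S i)) : LP R (Π₀ i, S i) := by
  classical
  intro B D _ _ _ _ q hq g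
  choose t ht using fun i => h i B D q hq (g ∘ₗ DFinsupp.lsingle i)
  refine ⟨DFinsupp.lsum ℕ t, ?_⟩
  apply DFinsupp.lhom_ext
  intro i x
  have := LinearMap.congr_fun (ht i) x
  simpa using this

theorem exists_cover (D : Type u) [AddCommGroup D] [Module R D] :
    ∃ (C : Type u) (_ : AddCommGroup C) (_ : Module R C) (c : C →ₗ[R] D), LP R C ∧ PureEpi c :=
  ⟨Cov R D, inferInstance, inferInstance, covMap R D,
    LP_directSum (fun i : CI R D => CS i) fun _ => LP_fp _, covMap_pure D⟩

theorem LP_retract {P Q : Type u} [AddCommGroup P] [Module R P] [AddCommGroup Q] [Module R Q]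
    (hQ : LP R Q) (s : P →ₗ[R] Q) (r : Q →ₗ[R] P) (h : r ∘ₗ s = LinearMap.id) : LP R P := by
  intro B D _ _ _ _ q hq g
  obtain ⟨t, ht⟩ := hQ B D q hq (g ∘ₗ r)
  refine ⟨t ∘ₗ s, ?_⟩
  rw [← LinearMap.comp_assoc, ht, LinearMap.comp_assoc, h, LinearMap.comp_id]

theorem LP_equiv {P Q : Type u} [AddCommGroup P] [Module R P] [AddCommGroup Q] [Module R Q]
    (e : P ≃ₗ[R] Q) (hQ : LP R Q) : LP R P :=
  LP_retract hQ e.toLinearMap e.symm.toLinearMap (by ext; simp)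

theorem LP_factor {Y H : Type u} [AddCommGroup Y] [Module R Y] [AddCommGroup H] [Module R H]
    [Module.Finite R H] (hY : LP R Y) (j : H →ₗ[R] Y) :
    ∃ (e : Y →ₗ[R] Y) (E : Submodule R Y), (∀ x, e (j x) = j x) ∧ (∀ y, e y ∈ E) ∧ E.FG := by
  classical
  obtain ⟨s, hs⟩ := hY (Cov R Y) _ (covMap R Y) (covMap_pure Y) LinearMap.id
  obtain ⟨t, ht⟩ := Module.Finite.fg_top (R := R) (M := H)
  let F : Finset (CI R Y) := t.biUnion (fun x => DFinsupp.support (s (j x)))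
  let tr : Cov R Y →ₗ[R] Cov R Y :=
    DFinsupp.filterLinearMap R (fun i : CI R Y => CS i) (fun i => i ∈ F)
  refine ⟨covMap R Y ∘ₗ tr ∘ₗ s, ⨆ i ∈ F, LinearMap.range (covMap R Y ∘ₗ
    DFinsupp.lsingle (M := fun i : CI R Y => CS i) i), ?_, ?_, ?_⟩
  · have : (covMap R Y ∘ₗ tr ∘ₗ s) ∘ₗ j = j := by
      apply LinearMap.ext_on_range (v := fun x : t => (x : H))
      · simpa using ht
      · rintro ⟨x, hx⟩
        have : tr (s (j x)) = s (j x) := by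
          apply DFinsupp.ext
          intro i
          simp only [tr, DFinsupp.filterLinearMap_apply, DFinsupp.filter_apply]
          split_ifs with h
          · rfl
          · by_contra hne
            apply h
            refine Finset.mem_biUnion.2 ⟨x, hx, ?_⟩
            exact DFinsupp.mem_support_iff.2 (fun h0 => hne h0.symm)
        simp only [LinearMap.comp_apply, this]
        have := LinearMap.congr_fun hs (j x)
        simpa using this
    exact fun x => LinearMap.congr_fun this x
  · intro y
    simp only [LinearMap.comp_apply]
    have hsum : tr (s y) = ∑ i ∈ (tr (s y)).support, DFinsupp.single i (tr (s y) i) :=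
      (DFinsupp.sum_single (f := tr (s y))).symm
    rw [hsum, map_sum]
    refine Submodule.sum_mem _ fun i hi => ?_
    have hiF : i ∈ F := by
      by_contra h
      rw [DFinsupp.mem_support_iff] at hi
      apply hi
      simp only [tr, DFinsupp.filterLinearMap_apply, DFinsupp.filter_apply, if_neg h]
    refine Submodule.mem_iSup_of_mem i (Submodule.mem_iSup_of_mem hiF ⟨tr (s y) i, rfl⟩)
  · refine Submodule.fg_biSup F _ fun i _ => ?_
    rw [LinearMap.range_eq_map]
    exact (Module.Finite.fg_top).map _

/-- closure of `LP` under extensions. -/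
def ExtLP (R : Type u) [Ring R] : Prop :=
  ∀ (A B C : Type u) [AddCommGroup A] [Module R A] [AddCommGroup B] [Module R B]
    [AddCommGroup C] [Module R C] (i : A →ₗ[R] B) (p : B →ₗ[R] C),
    Function.Injective i → Function.Surjective p → Function.Exact i p → LP R A → LP R C → LP R B

theorem star (hext : ExtLP R) {M : Type u} [AddCommGroup M] [Module R M] (H : Submodule R M)
    [Module.FinitePresentation R H] :
    ∃ H' : Submodule R M, H'.FG ∧ ∀ Z : Submodule R M, Module.FinitePresentation R Z →
      H ≤ Z → ∃ φ : Z →ₗ[R] M, (∀ z, φ z ∈ H') ∧ ∀ z : Z, (z : M) ∈ H → φ z = z := by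
  classical
  obtain ⟨C, _, _, c, hC, hc⟩ := exists_cover (R := R) (M ⧸ H)
  let Y : Submodule R (M × C) :=
    LinearMap.ker (H.mkQ ∘ₗ LinearMap.fst R M C -
      c ∘ₗ LinearMap.snd R M C)
  have hYmem : ∀ x, x ∈ Y ↔ H.mkQ x.1 = c x.2 := by
    intro x; simp [Y, sub_eq_zero]
  let j : H →ₗ[R] Y := LinearMap.codRestrict Y
    (LinearMap.inl R M C ∘ₗ H.subtype) (by
      intro x; rw [hYmem]; simp)
  let p : Y →ₗ[R] C := LinearMap.snd R M C ∘ₗ Y.subtype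
  have hY : LP R Y := by
    refine hext H Y C j p ?_ ?_ ?_ (LP_fp H) hC
    · intro x y hxy
      have := congrArg (fun z : Y => z.1.1) hxy
      exact Subtype.ext this
    · intro x
      obtain ⟨m, hm⟩ := H.mkQ_surjective (c x)
      exact ⟨⟨(m, x), (hYmem _).2 hm⟩, rfl⟩
    · rintro ⟨⟨m, x⟩, hy⟩
      constructor
      · intro h
        have hx : x = 0 := h
        subst hx
        have := (hYmem _).1 hy
        simp at this
        exact ⟨⟨m, this⟩, rfl⟩
      · rintro ⟨z, hz⟩
        rw [← hz]; rfl
  obtain ⟨e, E, he, hE, hfg⟩ := LP_factor hY j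
  let π : Y →ₗ[R] M := LinearMap.fst R M C ∘ₗ Y.subtype
  refine ⟨E.map π, hfg.map _, fun Z hZ hHZ => ?_⟩
  -- lift `Z → M/H`, killing `H`
  let HZ : Submodule R Z := H.comap Z.subtype
  have : Module.FinitePresentation R (Z ⧸ HZ) := by
    refine Module.finitePresentation_of_surjective HZ.mkQ HZ.mkQ_surjective ?_
    rw [Submodule.ker_mkQ]
    have : Module.Finite R H := inferInstance
    have h1 : H.FG := Module.Finite.iff_fg.1 this
    refine Submodule.fg_of_fg_map_injective Z.subtype Z.injective_subtype ?_
    rw [Submodule.map_comap_eq, Submodule.range_subtype, inf_eq_right.2 hHZ]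
    exact h1
  obtain ⟨l, hl⟩ := hc (Z ⧸ HZ) (HZ.mapQ H Z.subtype le_rfl)
  let k : Z →ₗ[R] Y := LinearMap.codRestrict Y (LinearMap.prod Z.subtype (l ∘ₗ HZ.mkQ)) (by
    intro z
    rw [hYmem]
    have := LinearMap.congr_fun hl (HZ.mkQ z)
    simp only [LinearMap.comp_apply] at this
    exact this.symm)
  refine ⟨π ∘ₗ e ∘ₗ k, fun z => ⟨e (k z), hE _, rfl⟩, fun z hz => ?_⟩
  have hk : k z = j ⟨z, hz⟩ := by
    apply Subtype.ext
    apply Prod.ext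
    · rfl
    · have : HZ.mkQ z = 0 := by simpa [HZ] using hz
      simp [k, j, this]
  simp only [LinearMap.comp_apply, hk, he]
  rfl

end Stmt16P

namespace Stmt16P
variable {R : Type u} [Ring R]

/-- Elementary purity of a submodule. -/
def PureSub {M : Type u} [AddCommGroup M] [Module R M] (U : Submodule R M) : Prop :=
  ∀ (k : ℕ) (L : Submodule R (Fin k → R)), L.FG → ∀ f : (Fin k → R) →ₗ[R] M,
    (∀ x ∈ L, f x ∈ U) → ∃ f' : (Fin k → R) →ₗ[R] M, (∀ x, f' x ∈ U) ∧ ∀ x ∈ L, f' x = f x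

variable {M : Type u} [AddCommGroup M] [Module R M]

theorem FG.le_of_directed {V : Submodule R M} (hV : V.FG) {ι : Type*} [Nonempty ι]
    (U : ι → Submodule R M) (hU : Directed (· ≤ ·) U) (h : ∀ x ∈ V, ∃ i, x ∈ U i) :
    ∃ i, V ≤ U i := by
  have h1 : V ≤ ⨆ i, U i := by
    intro x hx
    obtain ⟨i, hi⟩ := h x hx
    exact Submodule.mem_iSup_of_mem i hi
  obtain ⟨_, ⟨i, rfl⟩, hi⟩ := (Submodule.fg_iff_compact V).1 hV (Set.range U) (⨆ i, U i)
    (Set.range_nonempty U) hU.directedOn_range isLUB_iSup h1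
  exact ⟨i, hi⟩

theorem PureSub.lift {U : Submodule R M} (hU : PureSub U) : PureEpi U.mkQ := by
  intro S _ _ _ g
  obtain ⟨k, L, hL, ⟨e⟩⟩ := exists_fin_pres (R := R) S
  obtain ⟨f, hf⟩ := Module.projective_lifting_property U.mkQ
    ((g ∘ₗ e.symm.toLinearMap) ∘ₗ L.mkQ) U.mkQ_surjective
  have hf' : ∀ x, U.mkQ (f x) = g (e.symm (L.mkQ x)) := fun x => LinearMap.congr_fun hf x
  obtain ⟨f', h1, h2⟩ := hU k L hL f (by
    intro x hx
    have := hf' x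
    have h0 : L.mkQ x = 0 := by simpa using hx
    rw [h0] at this
    simpa using this)
  refine ⟨L.liftQ (f - f') (by
    intro x hx
    simp [h2 x hx]) ∘ₗ e.toLinearMap, ?_⟩
  ext s
  obtain ⟨x, hx⟩ := L.mkQ_surjective (e s)
  have h3 : U.mkQ (f' x) = 0 := by simpa using h1 x
  simp only [LinearMap.comp_apply, LinearEquiv.coe_coe, ← hx]
  rw [Submodule.mkQ_apply L, Submodule.liftQ_apply, LinearMap.sub_apply, map_sub, h3, hf', hx]
  simp

theorem PureSub.trans {U : Submodule R M} (hU : PureSub U) {C : Submodule R (M ⧸ U)}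
    (hC : PureSub C) : PureSub (C.comap U.mkQ) := by
  intro k L hL f hf
  obtain ⟨f2, h1, h2⟩ := hC k L hL (U.mkQ ∘ₗ f) hf
  obtain ⟨f3, hf3⟩ := Module.projective_lifting_property U.mkQ f2 U.mkQ_surjective
  have hf3' : ∀ x, U.mkQ (f3 x) = f2 x := fun x => LinearMap.congr_fun hf3 x
  obtain ⟨f4, h3, h4⟩ := hU k L hL (f - f3) (by
    intro x hx
    rw [← Submodule.ker_mkQ U, LinearMap.mem_ker, LinearMap.sub_apply, map_sub, hf3', h2 x hx]
    simp)
  refine ⟨f3 + f4, fun x => ?_, fun x hx => ?_⟩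
  · have : U.mkQ (f4 x) = 0 := by simpa using h3 x
    rw [Submodule.mem_comap, LinearMap.add_apply, map_add, this, hf3', add_zero]
    exact h1 x
  · simp [h4 x hx]

theorem PureSub.of_directed {ι : Type*} [Nonempty ι] (U : ι → Submodule R M)
    (hU : Directed (· ≤ ·) U) (h : ∀ i, PureSub (U i)) {V : Submodule R M}
    (hV : ∀ x, x ∈ V ↔ ∃ i, x ∈ U i) : PureSub V := by
  intro k L hL f hf
  obtain ⟨i, hi⟩ := FG.le_of_directed (hL.map f) U hU (by
    rintro _ ⟨x, hx, rfl⟩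
    exact (hV _).1 (hf x hx))
  obtain ⟨f', h1, h2⟩ := h i k L hL f (fun x hx => hi ⟨x, hx, rfl⟩)
  exact ⟨f', fun x => (hV _).2 ⟨i, h1 x⟩, h2⟩

theorem PureSub.bot : PureSub (⊥ : Submodule R M) := by
  intro k L hL f hf
  exact ⟨0, by simp, fun x hx => by simpa using (hf x hx).symm⟩

/-- Countable case: a union of a chain of f.p. submodules with the stabilising maps. -/
theorem LP_chain (C : ℕ → Submodule R M) (hmono : Monotone C)
    (hfp : ∀ n, Module.FinitePresentation R (C n))
    (hφ : ∀ n, ∃ φ : C (n + 2) →ₗ[R] M, (∀ z, φ z ∈ C (n + 1)) ∧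
      ∀ z : C (n + 2), (z : M) ∈ C n → φ z = z)
    (V : Submodule R M) (hV : ∀ x, x ∈ V ↔ ∃ n, x ∈ C n) : LP R V := by
  intro B D _ _ _ _ q hq g
  have hCV : ∀ n, C n ≤ V := fun n x hx => (hV x).2 ⟨n, hx⟩
  -- partial lifts
  let P : ℕ → Type u := fun n =>
    {h : C n →ₗ[R] B // ∀ x : C n, q (h x) = g ⟨x, hCV n x.2⟩}
  have base : ∀ n, Nonempty (P n) := by
    intro n
    obtain ⟨h, hh⟩ := hq (C n) (g ∘ₗ Submodule.inclusion (hCV n))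
    exact ⟨⟨h, fun x => LinearMap.congr_fun hh x⟩⟩
  have step : ∀ n (h : P (n + 1)), ∃ h' : P (n + 2),
      ∀ (x : M) (hx : x ∈ C n), h'.1 ⟨x, hmono (by omega) hx⟩ = h.1 ⟨x, hmono (by omega) hx⟩ := by
    intro n h
    obtain ⟨φ, h1, h2⟩ := hφ n
    obtain ⟨k⟩ := base (n + 2)
    let φ' : C (n + 2) →ₗ[R] C (n + 1) := φ.codRestrict _ h1
    let inc : C (n + 1) →ₗ[R] C (n + 2) := Submodule.inclusion (hmono (by omega))
    refine ⟨⟨k.1 + (h.1 - k.1 ∘ₗ inc) ∘ₗ φ', fun x => ?_⟩, fun x hx => ?_⟩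
    · simp only [LinearMap.add_apply, LinearMap.comp_apply, LinearMap.sub_apply, map_add, map_sub,
        k.2, h.2]
      simp [inc]
    · have : φ' ⟨x, hmono (by omega) hx⟩ = ⟨x, hmono (by omega) hx⟩ := by
        apply Subtype.ext
        exact h2 ⟨x, hmono (by omega) hx⟩ hx
      simp only [LinearMap.add_apply, LinearMap.comp_apply, LinearMap.sub_apply, this]
      simp [inc, Submodule.inclusion_apply]
  choose st hst using step
  let h : ∀ n, P (n + 1) := fun n => Nat.rec (base 1).some (fun n h => st n h) n
  have hh : ∀ n (x : M) (hx : x ∈ C n),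
      (h (n + 1)).1 ⟨x, hmono (by omega) hx⟩ = (h n).1 ⟨x, hmono (by omega) hx⟩ :=
    fun n x hx => hst n (h n) x hx
  -- value at x using any large stage
  have hind : ∀ n m (hnm : n ≤ m) (x : M) (hx : x ∈ C n),
      (h m).1 ⟨x, hmono (by omega) hx⟩ = (h n).1 ⟨x, hmono (by omega) hx⟩ := by
    intro n m hnm
    induction m, hnm using Nat.le_induction with
    | base => intro x hx; rfl
    | succ m hm ih =>
      intro x hx
      exact (hh m x (hmono hm hx)).trans (ih x hx)
  choose N hN using fun x : V => (hV x).1 x.2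
  have key : ∀ (x : V) n (hn : (x : M) ∈ C n),
      (h (N x)).1 ⟨x, hmono (by omega) (hN x)⟩ = (h n).1 ⟨x, hmono (by omega) hn⟩ := by
    intro x n hn
    rcases le_total (N x) n with hle | hle
    · exact (hind _ _ hle _ (hN x)).symm
    · exact hind _ _ hle _ hn
  refine ⟨⟨⟨fun x => (h (N x)).1 ⟨x, hmono (by omega) (hN x)⟩, ?_⟩, ?_⟩, ?_⟩
  · intro x y
    let n := max (N x) (N y)
    have hx : (x : M) ∈ C n := hmono (le_max_left _ _) (hN x)
    have hy : (y : M) ∈ C n := hmono (le_max_right _ _) (hN y)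
    have hxy : ((x + y : V) : M) ∈ C n := (C n).add_mem hx hy
    rw [key _ n hx, key _ n hy, key _ n hxy, ← map_add]
    rfl
  · intro r x
    have hx : ((r • x : V) : M) ∈ C (N x) := (C _).smul_mem r (hN x)
    simp only [RingHom.id_apply]
    rw [key _ (N x) hx, ← map_smul]
    rfl
  · ext x
    exact (h (N x)).2 _

end Stmt16P

namespace Stmt16P
variable {R : Type u} [Ring R] {M : Type u} [AddCommGroup M] [Module R M]

/-- Relative finite presentation of `V/U`. -/
def FPq (U V : Submodule R M) : Prop := Module.FinitePresentation R (V.map U.mkQ)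

/-- quotient comparison -/
theorem map_mkQ_equiv (U U' V : Submodule R M) (h : V ⊓ U = V ⊓ U') :
    Nonempty ((V.map U.mkQ) ≃ₗ[R] (V.map U'.mkQ)) := by
  have key : ∀ W : Submodule R M, Nonempty ((V ⧸ (V ⊓ W).comap V.subtype) ≃ₗ[R] V.map W.mkQ) := by
    intro W
    have h1 : LinearMap.ker (W.mkQ ∘ₗ V.subtype) = (V ⊓ W).comap V.subtype := by
      ext x; simp
    have h2 : LinearMap.range (W.mkQ ∘ₗ V.subtype) = V.map W.mkQ := by
      rw [LinearMap.range_comp, Submodule.range_subtype]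
    exact ⟨(Submodule.quotEquivOfEq _ _ h1.symm) ≪≫ₗ (W.mkQ ∘ₗ V.subtype).quotKerEquivRange ≪≫ₗ
      LinearEquiv.ofEq _ _ h2⟩
  obtain ⟨e1⟩ := key U
  obtain ⟨e2⟩ := key U'
  exact ⟨e1.symm ≪≫ₗ Submodule.quotEquivOfEq _ _ (by rw [h]) ≪≫ₗ e2⟩

theorem FPq_trans {U V W : Submodule R M} (hUV : U ≤ V) (hVW : V ≤ W) (h1 : FPq U V)
    (h2 : FPq V W) : FPq U W := by
  unfold FPq at *
  let f : M ⧸ U →ₗ[R] M ⧸ V := Submodule.factor hUV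
  have hf : ∀ x, f (U.mkQ x) = V.mkQ x := fun x => rfl
  let l : W.map U.mkQ →ₗ[R] W.map V.mkQ := f.restrict (by
    rintro _ ⟨x, hx, rfl⟩
    exact ⟨x, hx, rfl⟩)
  have hl : Function.Surjective l := by
    rintro ⟨_, ⟨x, hx, rfl⟩⟩
    exact ⟨⟨U.mkQ x, ⟨x, hx, rfl⟩⟩, rfl⟩
  have hle : V.map U.mkQ ≤ W.map U.mkQ := Submodule.map_mono hVW
  have hker : LinearMap.ker l = (V.map U.mkQ).comap (W.map U.mkQ).subtype := by
    ext ⟨_, ⟨x, hx, rfl⟩⟩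
    rw [LinearMap.mem_ker, ← Subtype.coe_inj]
    change f (U.mkQ x) = 0 ↔ U.mkQ x ∈ V.map U.mkQ
    rw [hf]
    constructor
    · intro h
      exact ⟨x, by simpa using h, rfl⟩
    · rintro ⟨y, hy, hyx⟩
      have := congrArg f hyx
      rw [hf, hf] at this
      rw [← this]; simpa using hy
  have : Module.FinitePresentation R (LinearMap.ker l) := by
    rw [hker]
    exact Module.FinitePresentation.of_equiv (M := V.map U.mkQ)
      (N := (V.map U.mkQ).comap (W.map U.mkQ).subtype) (Submodule.comapSubtypeEquivOfLe hle).symm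
  exact Module.finitePresentation_of_ker l hl

section Hill
variable {A : Type u} [LinearOrder A] [WellFoundedLT A] (T : A → Submodule R M)

/-- Span of a set of cells. -/
def sp (X : Set A) : Submodule R M := ⨆ a ∈ X, T a

theorem sp_mono {X Y : Set A} (h : X ⊆ Y) : sp T X ≤ sp T Y :=
  biSup_mono h

theorem le_sp {X : Set A} {a : A} (h : a ∈ X) : T a ≤ sp T X := le_biSup T h

theorem sp_le {X : Set A} {V : Submodule R M} (h : ∀ a ∈ X, T a ≤ V) : sp T X ≤ V :=
  iSup₂_le h

theorem sp_union (X Y : Set A) : sp T (X ∪ Y) = sp T X ⊔ sp T Y := iSup_union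

theorem mem_sp_iUnion {ι : Type*} [Nonempty ι] (Y : ι → Set A) (hY : Directed (· ⊆ ·) Y) (z : M) :
    z ∈ sp T (⋃ i, Y i) ↔ ∃ i, z ∈ sp T (Y i) := by
  have : sp T (⋃ i, Y i) = ⨆ i, sp T (Y i) := by
    unfold sp
    exact iSup_iUnion Y T
  rw [this, Submodule.mem_iSup_of_directed]
  intro i j
  obtain ⟨k, h1, h2⟩ := hY i j
  exact ⟨k, sp_mono T h1, sp_mono T h2⟩

theorem sp_cut (Y : Set A) (z : M) (hz : z ∈ sp T Y) :
    z = 0 ∨ ∃ c ∈ Y, z ∈ sp T (Y ∩ Set.Iic c) := by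
  have : sp T Y = ⨆ a : Y, T a := iSup_subtype'
  rw [this] at hz
  refine Submodule.iSup_induction (motive := fun z => z = 0 ∨ ∃ c ∈ Y, z ∈ sp T (Y ∩ Set.Iic c))
    _ hz ?_ ?_ ?_
  · rintro ⟨a, ha⟩ x hx
    exact Or.inr ⟨a, ha, le_sp T (X := Y ∩ Set.Iic a) ⟨ha, le_refl a⟩ hx⟩
  · exact Or.inl rfl
  · rintro x y (rfl | ⟨c, hc, hx⟩) (rfl | ⟨d, hd, hy⟩)
    · simp
    · right; exact ⟨d, hd, by simpa using hy⟩
    · right; exact ⟨c, hc, by simpa using hx⟩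
    · right
      rcases le_total c d with h | h
      · exact ⟨d, hd, Submodule.add_mem _ (sp_mono T (Set.inter_subset_inter_right _
          (Set.Iic_subset_Iic.2 h)) hx) hy⟩
      · exact ⟨c, hc, Submodule.add_mem _ hx (sp_mono T (Set.inter_subset_inter_right _
          (Set.Iic_subset_Iic.2 h)) hy)⟩

theorem exists_supp (hFG : ∀ a, (T a).FG) (hFP : ∀ a, FPq (sp T (Set.Iio a)) (T a)) (a : A) :
    ∃ F : Finset A, (∀ b ∈ F, b < a) ∧ T a ⊓ sp T (Set.Iio a) ≤ sp T (F : Set A) := by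
  classical
  set U := sp T (Set.Iio a) with hU
  have h := hFP a
  unfold FPq at h
  let l : T a →ₗ[R] (T a).map U.mkQ := U.mkQ.restrict (fun x hx => ⟨x, hx, rfl⟩)
  have hl : Function.Surjective l := by
    rintro ⟨_, ⟨x, hx, rfl⟩⟩
    exact ⟨⟨x, hx⟩, rfl⟩
  have : Module.Finite R (T a) := Module.Finite.iff_fg.2 (hFG a)
  have hk := Module.FinitePresentation.fg_ker l hl
  have hk' : (T a ⊓ U).FG := by
    have : T a ⊓ U = (LinearMap.ker l).map (T a).subtype := by
      ext x
      constructor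
      · rintro ⟨h1, h2⟩
        refine ⟨⟨x, h1⟩, ?_, rfl⟩
        change l _ = 0
        apply Subtype.ext
        change U.mkQ x = 0
        simpa using h2
      · rintro ⟨⟨y, hy⟩, h1, rfl⟩
        refine ⟨hy, ?_⟩
        have h2 : U.mkQ y = 0 := congrArg Subtype.val (show l ⟨y, hy⟩ = 0 from h1)
        simpa using h2
    rw [this]
    exact hk.map _
  have : Nonempty {F : Finset A // ∀ b ∈ F, b < a} := ⟨⟨∅, by simp⟩⟩
  obtain ⟨F, hF⟩ := FG.le_of_directed hk'
    (fun F : {F : Finset A // ∀ b ∈ F, b < a} => sp T (F.1 : Set A)) (by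
      intro F G
      refine ⟨⟨F.1 ∪ G.1, ?_⟩, sp_mono T (by simp), sp_mono T (by simp)⟩
      intro b hb
      rcases Finset.mem_union.1 hb with h | h
      · exact F.2 b h
      · exact G.2 b h) (by
      rintro x ⟨-, hx⟩
      rw [hU] at hx
      have hx' : x ∈ sp T (⋃ F : {F : Finset A // ∀ b ∈ F, b < a}, (F.1 : Set A)) := by
        refine sp_mono T ?_ hx
        intro b hb
        exact Set.mem_iUnion.2 ⟨⟨{b}, by simpa using hb⟩, by simp⟩
      rw [mem_sp_iUnion] at hx'
      · exact hx'
      · intro F G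
        refine ⟨⟨F.1 ∪ G.1, ?_⟩, by simp, by simp⟩
        intro b hb
        rcases Finset.mem_union.1 hb with h | h
        · exact F.2 b h
        · exact G.2 b h)
  exact ⟨F.1, F.2, hF⟩

variable (supp : A → Finset A)

/-- Closed sets of cells. -/
def Clo (X : Set A) : Prop := ∀ a ∈ X, (supp a : Set A) ⊆ X

theorem Clo.union {X Y : Set A} (hX : Clo supp X) (hY : Clo supp Y) : Clo supp (X ∪ Y) := by
  rintro a (h | h)
  · exact (hX a h).trans Set.subset_union_left
  · exact (hY a h).trans Set.subset_union_right

theorem Clo.iUnion {ι : Sort*} {X : ι → Set A} (hX : ∀ i, Clo supp (X i)) :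
    Clo supp (⋃ i, X i) := by
  intro a h
  obtain ⟨i, hi⟩ := Set.mem_iUnion.1 h
  exact (hX i a hi).trans (Set.subset_iUnion X i)

theorem exists_clo (hs1 : ∀ a, ∀ b ∈ supp a, b < a)
    (a : A) : ∃ F : Finset A, a ∈ F ∧ Clo supp (F : Set A) := by
  classical
  induction a using WellFoundedLT.induction with
  | ind a ih =>
    choose! F h1 h2 using ih
    refine ⟨insert a ((supp a).biUnion F), by simp, ?_⟩
    intro b hb
    have hb' : b = a ∨ ∃ c ∈ supp a, b ∈ F c := by simpa using hb
    rcases hb' with rfl | ⟨c, hc, hbc⟩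
    · intro c hc
      have hc' : c ∈ supp b := hc
      simp only [Finset.coe_insert, Finset.coe_biUnion, Set.mem_insert_iff, Set.mem_iUnion]
      exact Or.inr ⟨c, hc', h1 c (hs1 b c hc')⟩
    · intro d hd
      have := h2 c (hs1 a c hc) b hbc hd
      simp only [Finset.coe_insert, Finset.coe_biUnion, Set.mem_insert_iff, Set.mem_iUnion]
      exact Or.inr ⟨c, hc, this⟩

theorem sp_inter (hs1 : ∀ a, ∀ b ∈ supp a, b < a)
    (hs2 : ∀ a, T a ⊓ sp T (Set.Iio a) ≤ sp T (supp a : Set A))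
    {X I : Set A} (hX : Clo supp X) (hI : IsLowerSet I) (z : M) (hz : z ∈ sp T X)
    (hz' : z ∈ sp T I) : z ∈ sp T (X ∩ I) := by
  have main : ∀ c : A, ∀ z ∈ sp T (X ∩ Set.Iic c), z ∈ sp T I → z ∈ sp T (X ∩ I) := by
    intro c
    induction c using WellFoundedLT.induction with
    | ind c ih =>
      intro z hz hz'
      by_cases hcI : c ∈ I
      · exact sp_mono T (Set.inter_subset_inter_right _ (fun d hd => hI hd hcI)) hz
      have hIc : I ⊆ Set.Iio c := by
        intro d hd
        by_contra hdc
        exact hcI (hI (not_lt.1 hdc) hd)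
      have hz1 : z ∈ sp T (X ∩ Set.Iio c) := by
        by_cases hcX : c ∈ X
        · have : X ∩ Set.Iic c = (X ∩ Set.Iio c) ∪ {c} := by
            ext d
            simp only [Set.mem_inter_iff, Set.mem_Iic, Set.mem_union, Set.mem_Iio,
              Set.mem_singleton_iff, le_iff_lt_or_eq]
            constructor
            · rintro ⟨h1, h2 | h2⟩
              · exact Or.inl ⟨h1, h2⟩
              · exact Or.inr h2
            · rintro (⟨h1, h2⟩ | rfl)
              · exact ⟨h1, Or.inl h2⟩
              · exact ⟨hcX, Or.inr rfl⟩
          rw [this, sp_union] at hz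
          obtain ⟨y, hy, t, ht, rfl⟩ := Submodule.mem_sup.1 hz
          have ht1 : t ∈ T c := by
            refine (sp_le T (X := {c}) ?_) ht
            rintro d rfl
            exact le_rfl
          have ht2 : t ∈ sp T (Set.Iio c) := by
            have := Submodule.sub_mem _ (sp_mono T hIc hz')
              (sp_mono T (Set.inter_subset_right (s := X)) hy)
            simpa using this
          have ht3 := hs2 c ⟨ht1, ht2⟩
          refine Submodule.add_mem _ hy (sp_mono T ?_ ht3)
          intro d hd
          exact ⟨hX c hcX hd, hs1 c d hd⟩
        · refine sp_mono T ?_ hz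
          rintro d ⟨h1, h2⟩
          refine ⟨h1, lt_of_le_of_ne h2 ?_⟩
          rintro rfl
          exact hcX h1
      rcases sp_cut T _ z hz1 with rfl | ⟨d, ⟨hd1, hd2⟩, hzd⟩
      · exact Submodule.zero_mem _
      · refine ih d hd2 z (sp_mono T ?_ hzd) hz'
        rintro e ⟨⟨h1, h2⟩, h3⟩
        exact ⟨h1, h3⟩
  rcases sp_cut T _ z hz with rfl | ⟨d, -, hzd⟩
  · exact Submodule.zero_mem _
  · exact main d z hzd hz'

theorem FPq_insert (hs1 : ∀ a, ∀ b ∈ supp a, b < a)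
    (hs2 : ∀ a, T a ⊓ sp T (Set.Iio a) ≤ sp T (supp a : Set A))
    (hFP : ∀ a, FPq (sp T (Set.Iio a)) (T a)) {X : Set A} (hX : Clo supp X) (a : A)
    (ha : a ∉ X) (hsa : (supp a : Set A) ⊆ X) : FPq (sp T X) (sp T (X ∪ {a})) := by
  have h1 : T a ⊓ sp T (Set.Iio a) = T a ⊓ sp T X := by
    apply le_antisymm
    · exact le_inf inf_le_left ((hs2 a).trans (sp_mono T hsa))
    · refine le_inf inf_le_left ?_
      rintro t ⟨ht1, ht2⟩
      have := sp_inter T supp hs1 hs2 hX (isLowerSet_Iic a) t ht2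
        (le_sp T (X := Set.Iic a) (le_refl a) ht1)
      refine sp_mono T ?_ this
      rintro d ⟨hd1, hd2⟩
      refine lt_of_le_of_ne hd2 ?_
      rintro rfl
      exact ha hd1
  obtain ⟨e⟩ := map_mkQ_equiv _ _ _ h1
  have := hFP a
  unfold FPq at this ⊢
  have h2 : (sp T (X ∪ {a})).map (sp T X).mkQ = (T a).map (sp T X).mkQ := by
    have h3 : sp T ({a} : Set A) = T a := by simp [sp]
    rw [sp_union, Submodule.map_sup, h3, Submodule.mkQ_map_self, bot_sup_eq]
  rw [h2]
  exact Module.FinitePresentation.of_equiv e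

theorem FPq_finite (hs1 : ∀ a, ∀ b ∈ supp a, b < a)
    (hs2 : ∀ a, T a ⊓ sp T (Set.Iio a) ≤ sp T (supp a : Set A))
    (hFP : ∀ a, FPq (sp T (Set.Iio a)) (T a)) {X : Set A} (hX : Clo supp X)
    (F : Finset A) (hF : Clo supp (X ∪ F)) : FPq (sp T X) (sp T (X ∪ F)) := by
  classical
  induction F using Finset.induction_on_max with
  | empty =>
    unfold FPq
    have h0 : (sp T (X ∪ ((∅ : Finset A) : Set A))).map (sp T X).mkQ = ⊥ := by
      rw [Finset.coe_empty, Set.union_empty, Submodule.mkQ_map_self]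
    rw [h0]
    exact Module.finitePresentation_of_projective R _
  | insert a F hmax ih =>
    by_cases ha : a ∈ X
    · have : X ∪ ((insert a F : Finset A) : Set A) = X ∪ F := by
        ext b; simp only [Finset.coe_insert, Set.mem_union, Set.mem_insert_iff]
        constructor
        · rintro (h | rfl | h)
          · exact Or.inl h
          · exact Or.inl ha
          · exact Or.inr h
        · rintro (h | h)
          · exact Or.inl h
          · exact Or.inr (Or.inr h)
      rw [this] at hF ⊢
      exact ih hF
    · have hXF : Clo supp (X ∪ F) := by
        rintro b (hb | hb) c hc
        · exact Or.inl (hX b hb hc)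
        · have h1 := hF b (Or.inr (by simp [show b ∈ F from hb])) hc
          have h2 : c < b := hs1 b c hc
          rcases h1 with h1 | h1
          · exact Or.inl h1
          · have h3 : c = a ∨ c ∈ F := by simpa using h1
            rcases h3 with rfl | h3
            · exact absurd (hmax b hb) (not_lt.2 h2.le)
            · exact Or.inr h3
      have haF : a ∉ X ∪ (F : Set A) := by
        rintro (h | h)
        · exact ha h
        · exact lt_irrefl a (hmax a h)
      have hsa : (supp a : Set A) ⊆ X ∪ F := by
        intro c hc
        have h1 := hF a (Or.inr (by simp)) hc
        rcases h1 with h1 | h1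
        · exact Or.inl h1
        · have h3 : c = a ∨ c ∈ F := by simpa using h1
          rcases h3 with rfl | h3
          · exact absurd (hs1 c c hc) (lt_irrefl c)
          · exact Or.inr h3
      have h4 := FPq_insert T supp hs1 hs2 hFP hXF a haF hsa
      have h5 : X ∪ ((insert a F : Finset A) : Set A) = (X ∪ F) ∪ {a} := by
        ext b; simp
      rw [h5]
      exact FPq_trans (sp_mono T Set.subset_union_left) (sp_mono T Set.subset_union_left)
        (ih hXF) h4

end Hill
end Stmt16P

namespace Stmt16P
variable {R : Type u} [Ring R] {M : Type u} [AddCommGroup M] [Module R M]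

theorem chain_exists (hext : ExtLP R) {I : Type*} [Preorder I]
    (hdir : ∀ i j : I, ∃ k, i ≤ k ∧ j ≤ k) (C : I → Submodule R M) (hmono : Monotone C)
    (hfp : ∀ i, Module.FinitePresentation R (C i)) (hall : ∀ x, ∃ i, x ∈ C i) (i0 : I) :
    ∃ s : ℕ → I, Monotone s ∧ s 0 = i0 ∧ ∀ V : Submodule R M, (∀ x, x ∈ V ↔ ∃ n, x ∈ C (s n)) →
      PureSub V ∧ LP R V := by
  have hne : Nonempty I := ⟨i0⟩
  have hdirC : Directed (· ≤ ·) C := by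
    intro i j
    obtain ⟨k, h1, h2⟩ := hdir i j
    exact ⟨k, hmono h1, hmono h2⟩
  have hnext : ∀ i, ∃ j, i ≤ j ∧ ∀ Z : Submodule R M, Module.FinitePresentation R Z →
      C i ≤ Z → ∃ φ : Z →ₗ[R] M, (∀ z, φ z ∈ C j) ∧ ∀ z : Z, (z : M) ∈ C i → φ z = z := by
    intro i
    have := hfp i
    obtain ⟨H', h1, h2⟩ := star hext (C i)
    obtain ⟨j, hj⟩ := FG.le_of_directed h1 C hdirC (fun x _ => hall x)
    obtain ⟨k, hk1, hk2⟩ := hdir i j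
    refine ⟨k, hk1, ?_⟩
    intro Z hZ hle
    obtain ⟨φ, h3, h4⟩ := h2 Z hZ hle
    exact ⟨φ, fun z => hmono hk2 (hj (h3 z)), h4⟩
  choose nx hnx1 hnx2 using hnext
  let s : ℕ → I := fun n => nx^[n] i0
  have hs : ∀ n, s (n + 1) = nx (s n) := fun n => Function.iterate_succ_apply' nx n i0
  have hsm : Monotone s := monotone_nat_of_le_succ (fun n => by rw [hs]; exact hnx1 _)
  refine ⟨s, hsm, rfl, ?_⟩
  intro V hV
  constructor
  · intro k L hL f hf
    obtain ⟨n, hn⟩ := FG.le_of_directed (hL.map f) (fun n => C (s n))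
      (hmono.comp hsm).directed_le (by
        rintro _ ⟨x, hx, rfl⟩
        exact (hV _).1 (hf x hx))
    have hr : (LinearMap.range f).FG := by
      rw [LinearMap.range_eq_map]
      exact Module.Finite.fg_top.map f
    obtain ⟨j, hj⟩ := FG.le_of_directed hr C hdirC (fun x _ => hall x)
    obtain ⟨k', hk1, hk2⟩ := hdir (s n) j
    obtain ⟨φ, h3, h4⟩ := hnx2 (s n) (C k') (hfp k') (hmono hk1)
    refine ⟨φ ∘ₗ f.codRestrict (C k') (fun x => hmono hk2 (hj ⟨x, rfl⟩)), ?_, ?_⟩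
    · intro x
      refine (hV _).2 ⟨n + 1, ?_⟩
      rw [hs]
      exact h3 _
    · intro x hx
      exact h4 _ (hn ⟨x, hx, rfl⟩)
  · refine LP_chain (fun n => C (s n)) (hmono.comp hsm) (fun n => hfp _) ?_ V hV
    intro n
    obtain ⟨φ, h3, h4⟩ := hnx2 (s n) (C (s (n + 2))) (hfp _) (hmono (hsm (by omega)))
    refine ⟨φ, fun z => ?_, h4⟩
    rw [hs]
    exact h3 z

section Hill
variable {A : Type u} [LinearOrder A] [WellFoundedLT A] (T : A → Submodule R M)
  (supp : A → Finset A)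

theorem hill_step (hext : ExtLP R) (hs1 : ∀ a, ∀ b ∈ supp a, b < a)
    (hs2 : ∀ a, T a ⊓ sp T (Set.Iio a) ≤ sp T (supp a : Set A))
    (hFP : ∀ a, FPq (sp T (Set.Iio a)) (T a)) (htop : sp T Set.univ = ⊤) {X : Set A}
    (hX : Clo supp X) (hp : PureSub (sp T X)) (a : A) :
    ∃ X', X ⊆ X' ∧ a ∈ X' ∧ Clo supp X' ∧ PureSub (sp T X') ∧
      LP R ((sp T X').map (sp T X).mkQ) := by
  classical
  obtain ⟨F0, ha, hF0⟩ := exists_clo supp hs1 a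
  let I := {F : Finset A // Clo supp (F : Set A)}
  let U := sp T X
  let C : I → Submodule R (M ⧸ U) := fun F => (sp T (X ∪ F.1)).map U.mkQ
  have hmono : Monotone C := by
    intro F G h
    exact Submodule.map_mono (sp_mono T (Set.union_subset_union_right _ (by exact_mod_cast h)))
  have hdir : ∀ i j : I, ∃ k, i ≤ k ∧ j ≤ k := by
    intro i j
    refine ⟨⟨i.1 ∪ j.1, ?_⟩, ?_, ?_⟩
    · rw [Finset.coe_union]; exact Clo.union supp i.2 j.2
    · exact Finset.subset_union_left (s₁ := i.1)
    · exact Finset.subset_union_right (s₂ := j.1)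
  have hne : Nonempty I := ⟨⟨F0, hF0⟩⟩
  have hall : ∀ x, ∃ i, x ∈ C i := by
    intro x
    obtain ⟨y, rfl⟩ := U.mkQ_surjective x
    have hy : y ∈ sp T (⋃ i : I, X ∪ (i.1 : Set A)) := by
      have : (⋃ i : I, X ∪ (i.1 : Set A)) = Set.univ := by
        rw [Set.eq_univ_iff_forall]
        intro b
        obtain ⟨F, hb, hF⟩ := exists_clo supp hs1 b
        exact Set.mem_iUnion.2 ⟨⟨F, hF⟩, Or.inr hb⟩
      rw [this, htop]; trivial
    rw [mem_sp_iUnion] at hy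
    · obtain ⟨i, hi⟩ := hy
      exact ⟨i, ⟨y, hi, rfl⟩⟩
    · intro i j
      obtain ⟨k, h1, h2⟩ := hdir i j
      exact ⟨k, Set.union_subset_union_right _ (by exact_mod_cast h1),
        Set.union_subset_union_right _ (by exact_mod_cast h2)⟩
  obtain ⟨s, hsm, hs0, hV⟩ := chain_exists hext hdir C hmono
    (fun i => FPq_finite T supp hs1 hs2 hFP hX i.1 (Clo.union supp hX i.2)) hall ⟨F0, hF0⟩
  have hsub : X ⊆ ⋃ n, X ∪ ((s n).1 : Set A) := fun x hx => Set.mem_iUnion.2 ⟨0, Or.inl hx⟩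
  obtain ⟨h1, h2⟩ := hV ((sp T (⋃ n, X ∪ ((s n).1 : Set A))).map U.mkQ) (by
    intro x
    constructor
    · rintro ⟨y, hy, rfl⟩
      rw [SetLike.mem_coe, mem_sp_iUnion] at hy
      · obtain ⟨n, hn⟩ := hy
        exact ⟨n, ⟨y, hn, rfl⟩⟩
      · refine Monotone.directed_le (f := fun n => X ∪ ((s n).1 : Set A)) ?_
        intro n m h
        exact Set.union_subset_union_right _ (by exact_mod_cast hsm h)
    · rintro ⟨n, y, hy, rfl⟩
      exact ⟨y, sp_mono T (Set.subset_iUnion (fun n => X ∪ ((s n).1 : Set A)) n) hy, rfl⟩)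
  refine ⟨⋃ n, X ∪ ((s n).1 : Set A), hsub, Set.mem_iUnion.2 ⟨0, Or.inr ?_⟩,
    Clo.iUnion supp (fun n => Clo.union supp hX (s n).2), ?_, h2⟩
  · rw [hs0]; exact ha
  · have h3 := hp.trans h1
    rw [Submodule.comap_map_mkQ, sup_eq_right.2 (sp_mono T hsub)] at h3
    exact h3

theorem hill_LP (hext : ExtLP R) (hFG : ∀ a, (T a).FG)
    (hFP : ∀ a, FPq (sp T (Set.Iio a)) (T a)) (htop : sp T Set.univ = ⊤) : LP R M := by
  classical
  choose supp hs1 hs2 using exists_supp T hFG hFP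
  intro B D _ _ _ _ q hq g
  let P : Set (M →ₗ.[R] B) := {f | ∃ X : Set A, Clo supp X ∧ f.domain = sp T X ∧
    PureSub f.domain ∧ ∀ x : f.domain, q (f x) = g x}
  have hP0 : (⊥ : M →ₗ.[R] B) ∈ P := by
    refine ⟨∅, fun a h => h.elim, ?_, PureSub.bot, ?_⟩
    · change (⊥ : Submodule R M) = _
      simp [sp]
    · rintro ⟨x, hx⟩
      have : x = 0 := (Submodule.mem_bot R).1 hx
      subst this
      have h0 : (⟨0, hx⟩ : (⊥ : M →ₗ.[R] B).domain) = 0 := rfl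
      rw [h0, LinearPMap.map_zero]
      simp
  obtain ⟨f, -, hf⟩ := zorn_le_nonempty₀ P (by
    intro c hc hchain y hy
    have hcd : DirectedOn (· ≤ ·) c := hchain.directedOn
    have hne : c.Nonempty := ⟨y, hy⟩
    refine ⟨LinearPMap.sSup c hcd, ?_, fun z hz => LinearPMap.le_sSup hcd hz⟩
    choose X hX1 hX2 hX3 hX4 using fun i : c => hc i.2
    have hnec : Nonempty c := ⟨⟨y, hy⟩⟩
    have hdir : Directed (· ≤ ·) (fun i : c => i.1.domain) := by
      intro i j
      obtain ⟨k, hk, h1, h2⟩ := hcd i.1 i.2 j.1 j.2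
      exact ⟨⟨k, hk⟩, h1.1, h2.1⟩
    have hmem : ∀ x, x ∈ (LinearPMap.sSup c hcd).domain ↔ ∃ i : c, x ∈ i.1.domain := by
      intro x
      rw [LinearPMap.mem_domain_sSup_iff hne hcd]
      simp
    refine ⟨⋃ i, X i, Clo.iUnion supp hX1, ?_, PureSub.of_directed _ hdir hX3 hmem, ?_⟩
    · ext x
      rw [hmem]
      have : sp T (⋃ i, X i) = ⨆ i, sp T (X i) := iSup_iUnion X T
      rw [this, Submodule.mem_iSup_of_directed]
      · simp only [hX2]
      · simpa only [← hX2] using hdir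
    · rintro ⟨x, hx⟩
      obtain ⟨i, hi⟩ := (hmem x).1 hx
      have := (LinearPMap.le_sSup hcd i.2).2 (x := ⟨x, hi⟩) (y := ⟨x, hx⟩) rfl
      rw [← this]
      exact hX4 i ⟨x, hi⟩) ⊥ hP0
  obtain ⟨⟨X, hX, hdom, hpure, hqf⟩, hmax⟩ := hf
  by_cases htopf : f.domain = ⊤
  · refine ⟨f.toFun ∘ₗ LinearMap.id.codRestrict f.domain (by simp [htopf]), ?_⟩
    ext x
    exact hqf ⟨x, _⟩
  exfalso
  have : ∃ a, ¬ T a ≤ f.domain := by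
    by_contra! h
    exact htopf (top_le_iff.1 (htop ▸ sp_le T (fun a _ => h a)))
  obtain ⟨a, ha⟩ := this
  obtain ⟨X', hXX', haX', hX', hp', hLP⟩ :=
    hill_step T supp hext hs1 hs2 hFP htop hX (hdom ▸ hpure) a
  have hle : f.domain ≤ sp T X' := hdom ▸ sp_mono T hXX'
  rw [← hdom] at hLP
  let U := f.domain
  let W := (sp T X').map U.mkQ
  obtain ⟨σ, hσ⟩ := hLP M (M ⧸ U) U.mkQ hpure.lift W.subtype
  obtain ⟨τ, hτ⟩ := hLP B D q hq (g ∘ₗ σ)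
  have hσ' : ∀ w : W, U.mkQ (σ w) = w := fun w => LinearMap.congr_fun hσ w
  have hτ' : ∀ w : W, q (τ w) = g (σ w) := fun w => LinearMap.congr_fun hτ w
  let m : sp T X' →ₗ[R] W := U.mkQ.restrict (fun x hx => ⟨x, hx, rfl⟩)
  have hm : ∀ x : sp T X', ((m x : W) : M ⧸ U) = U.mkQ x := fun x => rfl
  let d : sp T X' →ₗ[R] U := ((sp T X').subtype - σ ∘ₗ m).codRestrict U (by
    intro x
    have : U.mkQ ((x : M) - σ (m x)) = 0 := by rw [map_sub, hσ', hm, sub_self]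
    exact (Submodule.Quotient.mk_eq_zero U).1 this)
  have hd : ∀ x, ((d x : U) : M) = x - σ (m x) := fun x => rfl
  let f' : M →ₗ.[R] B := ⟨sp T X', f.toFun ∘ₗ d + τ ∘ₗ m⟩
  have hf' : ∀ x : sp T X', f' x = f (d x) + τ (m x) := fun x => rfl
  have hff' : f ≤ f' := by
    refine ⟨hle, ?_⟩
    rintro ⟨x, hx⟩ ⟨y, hy⟩ (rfl : x = y)
    have hm0 : m ⟨x, hy⟩ = 0 := by
      apply Subtype.ext
      rw [hm]
      simpa using hx
    have hd0 : d ⟨x, hy⟩ = ⟨x, hx⟩ := by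
      apply Subtype.ext
      rw [hd, hm0, map_zero, sub_zero]
    rw [show f' ⟨x, hy⟩ = f (d ⟨x, hy⟩) + τ (m ⟨x, hy⟩) from rfl, hm0, hd0, map_zero, add_zero]
  have hf'P : f' ∈ P := by
    refine ⟨X', hX', rfl, hp', ?_⟩
    intro x
    rw [show f' x = f (d x) + τ (m x) from rfl, map_add, hqf, hτ', hd, ← map_add, sub_add_cancel]
  exact ha ((le_sp T haX').trans (hmax hf'P hff').1)

end Hill
end Stmt16P

namespace Stmt16P
variable {R : Type u} [Ring R] {M : Type u} [AddCommGroup M] [Module R M]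

theorem FPq_of_cell {k : ℕ} (τ : (Fin k → R) →ₗ[R] M) (U : Submodule R M)
    (L : Submodule R (Fin k → R)) (hL : L.FG) (h : ∀ x, τ x ∈ U ↔ x ∈ L) :
    FPq U (LinearMap.range τ) := by
  unfold FPq
  have h1 : LinearMap.ker (U.mkQ ∘ₗ τ) = L := by
    ext x
    rw [← h x]
    simp
  have h2 : LinearMap.range (U.mkQ ∘ₗ τ) = (LinearMap.range τ).map U.mkQ :=
    LinearMap.range_comp _ _
  have : Module.FinitePresentation R ((Fin k → R) ⧸ L) :=
    Module.finitePresentation_of_surjective L.mkQ L.mkQ_surjective (by simpa using hL)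
  exact Module.FinitePresentation.of_equiv (M := (Fin k → R) ⧸ L)
    ((Submodule.quotEquivOfEq _ _ h1.symm) ≪≫ₗ (U.mkQ ∘ₗ τ).quotKerEquivRange ≪≫ₗ
      LinearEquiv.ofEq _ _ h2)

/-- Modules over `N`. -/
structure Ov (R : Type u) [Ring R] (N : Type u) [AddCommGroup N] [Module R N] where
  /-- carrier -/
  X : Type u
  [i1 : AddCommGroup X]
  [i2 : Module R X]
  /-- projection -/
  p : X →ₗ[R] N

attribute [instance] Ov.i1 Ov.i2

variable {N : Type u} [AddCommGroup N] [Module R N]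

/-- All attaching data for an object over `N`. -/
structure Cell (G : Ov R N) : Type u where
  /-- rank -/
  k : ℕ
  /-- relations -/
  L : Submodule R (Fin k → R)
  hL : L.FG
  /-- attaching map -/
  f : L →ₗ[R] G.X
  /-- the map to `N` -/
  e : (Fin k → R) →ₗ[R] N
  he : ∀ x : L, G.p (f x) = e x

/-- One step of the construction. -/
structure Step (G : Ov R N) where
  /-- next object -/
  nxt : Ov R N
  /-- inclusion -/
  inc : G.X →ₗ[R] nxt.X
  hinj : Function.Injective inc
  hp : ∀ x, nxt.p (inc x) = G.p x
  /-- the cells -/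
  τ : ∀ c : Cell G, (Fin c.k → R) →ₗ[R] nxt.X
  hτ : ∀ (c : Cell G) (x : c.L), τ c x = inc (c.f x)
  hτp : ∀ (c : Cell G) x, nxt.p (τ c x) = c.e x
  hind : ∀ (S : Set (Cell G)) (c : Cell G), c ∉ S → ∀ x,
    τ c x ∈ LinearMap.range inc ⊔ ⨆ d ∈ S, LinearMap.range (τ d) → x ∈ c.L
  htop : LinearMap.range inc ⊔ ⨆ d, LinearMap.range (τ d) = ⊤

theorem exists_step (G : Ov R N) : Nonempty (Step G) := by
  classical
  let D := Π₀ c : Cell G, (Fin c.k → R)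
  let Φ1 : (Π₀ c : Cell G, c.L) →ₗ[R] G.X := DFinsupp.lsum ℕ (fun c : Cell G => c.f)
  let Φ2 : (Π₀ c : Cell G, c.L) →ₗ[R] D :=
    DFinsupp.mapRange.linearMap (fun c : Cell G => c.L.subtype)
  let Φ : (Π₀ c : Cell G, c.L) →ₗ[R] (G.X × D) := LinearMap.prod (-Φ1) Φ2
  let Rel := LinearMap.range Φ
  have hΦ2 : ∀ d c, Φ2 d c = (d c : Fin c.k → R) := fun d c => rfl
  have hsingle : ∀ (c : Cell G) (x : c.L), Φ (DFinsupp.single c x) =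
      (-(c.f x), DFinsupp.single c (x : Fin c.k → R)) := by
    intro c x
    change (-(Φ1 _), Φ2 _) = _
    congr 1
    · congr 1
      exact DFinsupp.lsum_single ℕ (fun c : Cell G => c.f) c x
    · exact DFinsupp.mapRange_single (f := fun c : Cell G => c.L.subtype) (hf := fun _ => rfl)
  let p0 : G.X × D →ₗ[R] N := LinearMap.coprod G.p (DFinsupp.lsum ℕ (fun c : Cell G => c.e))
  have hp0s : ∀ (c : Cell G) x, p0 (0, DFinsupp.single c x) = c.e x := by
    intro c x
    change G.p 0 + _ = _
    rw [map_zero, zero_add]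
    exact DFinsupp.lsum_single ℕ (fun c : Cell G => c.e) c x
  have hp0i : ∀ m, p0 (m, 0) = G.p m := by
    intro m
    change G.p m + DFinsupp.lsum ℕ (fun c : Cell G => c.e) 0 = _
    rw [map_zero, add_zero]
  have hp0 : p0 ∘ₗ Φ = 0 := by
    apply DFinsupp.lhom_ext
    intro c x
    rw [LinearMap.comp_apply, hsingle]
    have : (-(c.f x), DFinsupp.single c (x : Fin c.k → R)) =
      -((c.f x, 0) : G.X × D) + (0, DFinsupp.single c (x : Fin c.k → R)) := by
      ext <;> simp
    rw [this, map_add, map_neg, hp0s, hp0i, c.he]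
    simp
  let π : (G.X × D) ⧸ Rel →ₗ[R] N := Rel.liftQ p0 (by
    rintro _ ⟨d, rfl⟩
    exact LinearMap.congr_fun hp0 d)
  let ψ : ∀ c : Cell G, ((G.X × D) ⧸ Rel) →ₗ[R] ((Fin c.k → R) ⧸ c.L) := fun c =>
    Rel.liftQ (c.L.mkQ ∘ₗ (DFinsupp.lapply (R := R) c : D →ₗ[R] (Fin c.k → R)) ∘ₗ
      LinearMap.snd R G.X D) (by
    rintro _ ⟨d, rfl⟩
    change c.L.mkQ (Φ2 d c) = 0
    rw [hΦ2]
    simp)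
  have hψ : ∀ c (m : G.X) (d : D), ψ c (Rel.mkQ (m, d)) = c.L.mkQ (d c) := fun c m d => rfl
  let inc : G.X →ₗ[R] (G.X × D) ⧸ Rel := Rel.mkQ ∘ₗ LinearMap.inl R G.X D
  let τ : ∀ c : Cell G, (Fin c.k → R) →ₗ[R] (G.X × D) ⧸ Rel := fun c =>
    Rel.mkQ ∘ₗ LinearMap.inr R G.X D ∘ₗ 
      DFinsupp.lsingle (M := fun c : Cell G => Fin c.k → R) c
  have hinc : ∀ m, inc m = Rel.mkQ (m, 0) := fun _ => rfl
  have hτd : ∀ c x, τ c x = Rel.mkQ (0, DFinsupp.single c x) := fun _ _ => rfl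
  refine ⟨⟨⟨(G.X × D) ⧸ Rel, π⟩, inc, ?_, fun x => hp0i x, τ, ?_, fun c x => hp0s c x, ?_, ?_⟩⟩
  · rw [injective_iff_map_eq_zero]
    intro m hm
    rw [hinc] at hm
    obtain ⟨d, hd⟩ := (Submodule.Quotient.mk_eq_zero Rel).1 hm
    have hd2 : Φ2 d = 0 := congrArg Prod.snd hd
    have hd0 : d = 0 := by
      ext c : 1
      apply Subtype.ext
      rw [← hΦ2, hd2]
      rfl
    have hd1 : -(Φ1 d) = m := congrArg Prod.fst hd
    rw [← hd1, hd0, map_zero, neg_zero]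
  · intro c x
    rw [hinc, hτd, ← sub_eq_zero, ← map_sub]
    refine (Submodule.Quotient.mk_eq_zero Rel).2 ⟨DFinsupp.single c x, ?_⟩
    rw [hsingle]
    ext <;> simp
  · intro S c hc x hx
    have hle : LinearMap.range inc ⊔ ⨆ d ∈ S, LinearMap.range (τ d) ≤ LinearMap.ker (ψ c) := by
      refine sup_le ?_ (iSup₂_le ?_)
      · rintro _ ⟨m, rfl⟩
        rw [LinearMap.mem_ker, hinc, hψ]
        exact map_zero c.L.mkQ
      · rintro d hd _ ⟨y, rfl⟩
        have hne : d ≠ c := fun h => hc (h ▸ hd)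
        rw [LinearMap.mem_ker, hτd, hψ, DFinsupp.single_eq_of_ne hne.symm, map_zero]
    have := hle hx
    rw [LinearMap.mem_ker, hτd, hψ, DFinsupp.single_eq_same] at this
    exact (Submodule.Quotient.mk_eq_zero c.L).1 this
  · rw [eq_top_iff]
    rintro z -
    obtain ⟨⟨m, d⟩, rfl⟩ := Rel.mkQ_surjective z
    have : Rel.mkQ (m, d) = inc m + Rel.mkQ (0, d) := by
      rw [hinc, ← map_add]
      simp
    rw [this]
    clear this
    refine Submodule.add_mem _ (Submodule.mem_sup_left ⟨m, rfl⟩) (Submodule.mem_sup_right ?_)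
    induction d using DFinsupp.induction with
    | h0 =>
      have : Rel.mkQ ((0, 0) : G.X × D) = 0 := map_zero _
      rw [this]
      exact Submodule.zero_mem _
    | ha c b f _ _ ih =>
      have : Rel.mkQ (0, DFinsupp.single c b + f) = τ c b + Rel.mkQ (0, f) := by
        rw [hτd, ← map_add]
        simp
      rw [this]
      refine Submodule.add_mem _ (Submodule.mem_iSup_of_mem c ⟨b, rfl⟩) ih

end Stmt16P

namespace Stmt16P
variable {R : Type u} [Ring R] {N : Type u} [AddCommGroup N] [Module R N]

theorem limit_exists (G : ℕ → Type u) [∀ n, AddCommGroup (G n)] [∀ n, Module R (G n)]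
    (ι : ∀ n, G n →ₗ[R] G (n + 1)) (hι : ∀ n, Function.Injective (ι n))
    (p : ∀ n, G n →ₗ[R] N) (hp : ∀ n x, p (n + 1) (ι n x) = p n x) :
    ∃ (M : Type u) (_ : AddCommGroup M) (_ : Module R M) (o : ∀ n, G n →ₗ[R] M) (π : M →ₗ[R] N),
      (∀ n, Function.Injective (o n)) ∧ (∀ n x, o (n + 1) (ι n x) = o n x) ∧
      (∀ x, ∃ n y, o n y = x) ∧ ∀ n x, π (o n x) = p n x := by
  classical
  let tr : ∀ i j, i ≤ j → G i →ₗ[R] G j := fun i j h =>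
    Nat.leRec (motive := fun m _ => G i →ₗ[R] G m) LinearMap.id (fun m _ g => ι m ∘ₗ g) h
  have tr0 : ∀ i (h : i ≤ i), tr i i h = LinearMap.id := fun i h => Nat.leRec_self _ _
  have trs : ∀ i j (h : i ≤ j) (h' : i ≤ j + 1), tr i (j + 1) h' = ι j ∘ₗ tr i j h :=
    fun i j h h' => Nat.leRec_succ _ _ h
  have trinj : ∀ i j h, Function.Injective (tr i j h) := by
    intro i j h
    induction j, h using Nat.le_induction with
    | base => rw [tr0]; exact fun _ _ h => h
    | succ j h ih =>
      rw [trs i j h]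
      exact (hι j).comp ih
  have trp : ∀ i j h x, p j (tr i j h x) = p i x := by
    intro i j h
    induction j, h using Nat.le_induction with
    | base => intro x; rw [tr0]; rfl
    | succ j h ih =>
      intro x
      rw [trs i j h, LinearMap.comp_apply, hp, ih]
  have hds : DirectedSystem G (fun i j h => tr i j h) := by
    constructor
    · intro i x
      rw [tr0]; rfl
    · intro k j i hij hjk x
      induction k, hjk using Nat.le_induction with
      | base => rw [tr0]; rfl
      | succ k h ih =>
        rw [trs j k h, trs i k (hij.trans h), LinearMap.comp_apply, ih, LinearMap.comp_apply]
  refine ⟨Module.DirectLimit G tr, inferInstance, inferInstance,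
    fun n => Module.DirectLimit.of R ℕ G tr n,
    Module.DirectLimit.lift R ℕ G tr p trp, ?_, ?_, ?_, ?_⟩
  · intro n x y h
    obtain ⟨j, hj, h1⟩ := Module.DirectLimit.exists_eq_of_of_eq h
    exact trinj _ _ _ h1
  · intro n x
    have h1 : tr n (n + 1) (Nat.le_succ n) x = ι n x := by
      rw [trs n n le_rfl, tr0]; rfl
    rw [← h1]
    exact Module.DirectLimit.of_f
  · intro x
    exact Module.DirectLimit.exists_of x
  · intro n x
    exact Module.DirectLimit.lift_of _ _ x

end Stmt16P

namespace Stmt16P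
variable {R : Type u} [Ring R]

theorem exists_wo_aux {A K : Type u} [LinearOrder K] [WellFoundedLT K] (e : A → K)
    (he : Function.Injective e) (d : A → ℕ) : ∃ (_ : LinearOrder A), WellFoundedLT A ∧
    (∀ a b : A, d a < d b → a < b) ∧ (∀ a b : A, a < b → d a ≤ d b) := by
  let F : A → ℕ ×ₗ K := fun a => toLex (d a, e a)
  have hF : Function.Injective F := fun a b h => he (congrArg (fun x => (ofLex x).2) h)
  let l1 : LinearOrder A := LinearOrder.lift' F hF
  have hlt : ∀ a b : A, a < b ↔ F a < F b := fun a b => Iff.rfl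
  refine ⟨l1, ⟨?_⟩, ?_, ?_⟩
  · exact InvImage.wf F (wellFounded_lt (α := ℕ ×ₗ K))
  · intro a b h
    rw [hlt]
    exact Prod.Lex.toLex_lt_toLex.2 (Or.inl h)
  · intro a b h
    rw [hlt] at h
    rcases Prod.Lex.toLex_lt_toLex.1 h with h | h
    · exact h.le
    · exact h.1.le

theorem exists_wo (A : Type u) (d : A → ℕ) : ∃ (_ : LinearOrder A), WellFoundedLT A ∧
    (∀ a b : A, d a < d b → a < b) ∧ (∀ a b : A, a < b → d a ≤ d b) := by
  classical
  exact @exists_wo_aux A A (linearOrderOfSTO WellOrderingRel)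
    ⟨(inferInstance : IsWellFounded A WellOrderingRel).wf⟩ id Function.injective_id d

theorem exists_special (hext : ExtLP R) (N : Type u) [AddCommGroup N] [Module R N] :
    ∃ (M : Type u) (_ : AddCommGroup M) (_ : Module R M) (π : M →ₗ[R] N), LP R M ∧
      Function.Surjective π ∧ ∀ (k : ℕ) (L : Submodule R (Fin k → R)), L.FG →
        ∀ f : L →ₗ[R] M, (∀ x, π (f x) = 0) →
          ∃ g : (Fin k → R) →ₗ[R] M, (∀ x, π (g x) = 0) ∧ ∀ x : L, g x = f x := by
  classical
  let st : ∀ G : Ov R N, Step G := fun G => (exists_step G).some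
  let G0 : Ov R N := { X := PUnit.{u+1}, p := 0 }
  let G : ℕ → Ov R N := fun n => Nat.rec (motive := fun _ => Ov R N) G0 (fun _ G => (st G).nxt) n
  have hG0 : Subsingleton (G 0).X := inferInstanceAs (Subsingleton PUnit.{u+1})
  let inc : ∀ n, (G n).X →ₗ[R] (G (n + 1)).X := fun n => (st (G n)).inc
  let τ : ∀ n (c : Cell (G n)), (Fin c.k → R) →ₗ[R] (G (n + 1)).X := fun n => (st (G n)).τ
  have hτ : ∀ n (c : Cell (G n)) (x : c.L), τ n c x = inc n (c.f x) := fun n => (st (G n)).hτ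
  have hτp : ∀ n (c : Cell (G n)) x, (G (n + 1)).p (τ n c x) = c.e x := fun n => (st (G n)).hτp
  have hind : ∀ n (S : Set (Cell (G n))) (c : Cell (G n)), c ∉ S → ∀ x,
      τ n c x ∈ LinearMap.range (inc n) ⊔ ⨆ d ∈ S, LinearMap.range (τ n d) → x ∈ c.L :=
    fun n => (st (G n)).hind
  have htop : ∀ n, LinearMap.range (inc n) ⊔ ⨆ d, LinearMap.range (τ n d) = ⊤ :=
    fun n => (st (G n)).htop
  obtain ⟨M, _, _, o, π, ho, hoi, hex, hπ⟩ := limit_exists (R := R) (fun n => (G n).X) inc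
    (fun n => (st (G n)).hinj) (fun n => (G n).p) (fun n => (st (G n)).hp)
  clear_value inc τ
  obtain ⟨_, _, hlt1, hlt2⟩ := exists_wo (Σ n, Cell (G n)) (fun a => a.1)
  clear_value G
  let A := Σ n, Cell (G n)
  let t : ∀ a : A, (Fin a.2.k → R) →ₗ[R] M := fun a => o (a.1 + 1) ∘ₗ τ a.1 a.2
  let T : A → Submodule R M := fun a => LinearMap.range (t a)
  have hrs : ∀ n, LinearMap.range (o n) ≤ LinearMap.range (o (n + 1)) := by
    rintro n _ ⟨x, rfl⟩
    exact ⟨inc n x, hoi n x⟩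
  have hrm : Monotone (fun n => LinearMap.range (o n)) := monotone_nat_of_le_succ hrs
  -- each stage is spanned by the earlier cells
  have hspan : ∀ n, LinearMap.range (o n) ≤ sp T {a : A | a.1 < n} := by
    intro n
    induction n with
    | zero =>
      rintro _ ⟨x, rfl⟩
      rw [Subsingleton.elim x 0, map_zero]
      exact Submodule.zero_mem _
    | succ n ih =>
      rw [LinearMap.range_eq_map, ← htop n, Submodule.map_sup, Submodule.map_iSup]
      refine sup_le ?_ (iSup_le ?_)
      · rintro _ ⟨_, ⟨x, rfl⟩, rfl⟩
        rw [hoi]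
        exact sp_mono T (fun a (ha : a.1 < n) => Nat.lt_succ_of_lt ha) (ih ⟨x, rfl⟩)
      · intro d
        rw [← LinearMap.range_comp]
        exact le_sp T (X := {a : A | a.1 < n + 1}) (a := ⟨n, d⟩) (Nat.lt_succ_self n)
  have hsptop : sp T Set.univ = ⊤ := by
    rw [eq_top_iff]
    rintro x -
    obtain ⟨n, y, rfl⟩ := hex x
    exact sp_mono T (Set.subset_univ _) (hspan n ⟨y, rfl⟩)
  have hFG : ∀ a, (T a).FG := by
    intro a
    change (LinearMap.range (t a)).FG
    rw [LinearMap.range_eq_map]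
    exact Module.Finite.fg_top.map _
  have hFP : ∀ a, FPq (sp T (Set.Iio a)) (T a) := by
    rintro ⟨n, c⟩
    refine FPq_of_cell (t ⟨n, c⟩) _ c.L c.hL ?_
    intro x
    let S : Set (Cell (G n)) := {d | (⟨n, d⟩ : A) < ⟨n, c⟩}
    constructor
    · intro hx
      have hle : sp T (Set.Iio ⟨n, c⟩) ≤
          (LinearMap.range (inc n) ⊔ ⨆ d ∈ S, LinearMap.range (τ n d)).map (o (n + 1)) := by
        refine sp_le T ?_
        rintro ⟨m, d⟩ hmd
        rcases (hlt2 _ _ hmd).lt_or_eq with h | h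
        · rintro _ ⟨y, rfl⟩
          have h1 : t ⟨m, d⟩ y ∈ LinearMap.range (o n) :=
            hrm (Nat.succ_le_of_lt h) ⟨τ m d y, rfl⟩
          obtain ⟨z, hz⟩ := h1
          rw [← hz, ← hoi]
          exact ⟨inc n z, Submodule.mem_sup_left ⟨z, rfl⟩, rfl⟩
        · obtain rfl : m = n := h
          rintro _ ⟨y, rfl⟩
          refine ⟨τ m d y, Submodule.mem_sup_right ?_, rfl⟩
          exact (le_iSup₂_of_le (f := fun d (_ : d ∈ S) => LinearMap.range (τ m d)) d hmd le_rfl)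
            ⟨y, rfl⟩
      obtain ⟨z, hz, hzx⟩ := hle hx
      have hzx' : z = τ n c x := ho _ hzx
      rw [hzx'] at hz
      exact hind n S c (fun h : (⟨n, c⟩ : A) < ⟨n, c⟩ => lt_irrefl _ h) x hz
    · intro hx
      have h1 : t ⟨n, c⟩ x = o n (c.f ⟨x, hx⟩) := by
        rw [← hoi, ← hτ]
        rfl
      rw [h1]
      exact sp_mono T (fun a (ha : a.1 < n) => hlt1 a ⟨n, c⟩ ha) (hspan n ⟨_, rfl⟩)
  refine ⟨M, inferInstance, inferInstance, π, hill_LP T hext hFG hFP hsptop, ?_, ?_⟩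
  · intro y
    let c : Cell (G 0) := ⟨1, ⊥, Submodule.fg_bot, 0,
      (LinearMap.toSpanSingleton R N y) ∘ₗ (LinearMap.proj (0 : Fin 1)), by
        rintro ⟨x, hx⟩
        have : x = 0 := by simpa using hx
        subst this
        simp⟩
    have hc := hτp 0 c (fun _ => 1)
    refine ⟨o 1 (τ 0 c (fun _ => 1)), ?_⟩
    rw [hπ, hc]
    change (1 : R) • y = y
    exact one_smul R y
  · intro k L hL f hf
    have hfin : Module.Finite R L := Module.Finite.iff_fg.2 hL
    have hr : (LinearMap.range f).FG := by
      rw [LinearMap.range_eq_map]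
      exact Module.Finite.fg_top.map f
    obtain ⟨n, hn⟩ := FG.le_of_directed hr (fun n => LinearMap.range (o n)) hrm.directed_le
      (fun x _ => by
        obtain ⟨n, y, h⟩ := hex x
        exact ⟨n, y, h⟩)
    let eo := LinearEquiv.ofInjective (o n) (ho n)
    let f' : L →ₗ[R] (G n).X := eo.symm.toLinearMap ∘ₗ
      f.codRestrict (LinearMap.range (o n)) (fun x => hn ⟨x, rfl⟩)
    have hf' : ∀ x, o n (f' x) = f x := by
      intro x
      have h1 : eo (f' x) = f.codRestrict (LinearMap.range (o n)) (fun x => hn ⟨x, rfl⟩) x :=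
        eo.apply_symm_apply _
      exact congrArg Subtype.val h1
    let c : Cell (G n) := ⟨k, L, hL, f', 0, by
      intro x
      rw [← hπ, hf', hf]
      rfl⟩
    refine ⟨o (n + 1) ∘ₗ τ n c, ?_, ?_⟩
    · intro x
      rw [LinearMap.comp_apply, hπ]
      exact hτp n c x
    · intro x
      rw [LinearMap.comp_apply, ← hf']
      exact (congrArg (o (n + 1)) (hτ n c x)).trans (hoi n _)

end Stmt16P

namespace Stmt16P
open Stmt16
variable {R : Type u} [Ring R]

theorem mkSES {A B C : Type u} [AddCommGroup A] [Module R A] [AddCommGroup B] [Module R B]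
    [AddCommGroup C] [Module R C] (i : A →ₗ[R] B) (p : B →ₗ[R] C) (hi : Function.Injective i)
    (hp : Function.Surjective p) (hex : Function.Exact i p) :
    ∃ h : ModuleCat.ofHom i ≫ ModuleCat.ofHom p = 0,
      (ShortComplex.mk (ModuleCat.ofHom i) (ModuleCat.ofHom p) h).ShortExact := by
  have h : ModuleCat.ofHom i ≫ ModuleCat.ofHom p = 0 := by
    ext x
    exact hex.apply_apply_eq_zero x
  refine ⟨h, ?_⟩
  have : Mono (ModuleCat.ofHom i) := (ModuleCat.mono_iff_injective _).2 hi
  have : Epi (ModuleCat.ofHom p) := (ModuleCat.epi_iff_surjective _).2 hp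
  refine { exact := ?_, mono_f := ‹_›, epi_g := ‹_› }
  rw [ShortComplex.ShortExact.moduleCat_exact_iff_function_exact]
  exact hex

theorem LP_of_pureProjective {P : ModuleCat.{u} R} (h : IsPureProjective P) : LP R P := by
  obtain ⟨ι, M, hM, s, r, hsr⟩ := h
  have hc : LP R (∐ M : ModuleCat.{u} R) := by
    intro B D _ _ _ _ q hq g
    choose t ht using fun i => @hq (M i) _ _ (hM i) (g ∘ₗ (Sigma.ι M i).hom)
    let t' : (∐ M) ⟶ ModuleCat.of R B := Sigma.desc (fun i => ModuleCat.ofHom (t i))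
    refine ⟨t'.hom, ?_⟩
    have : t' ≫ ModuleCat.ofHom q = ModuleCat.ofHom g := by
      apply Sigma.hom_ext
      intro i
      rw [Sigma.ι_desc_assoc]
      ext x
      exact LinearMap.congr_fun (ht i) x
    exact congrArg ModuleCat.Hom.hom this
  exact LP_retract hc s.hom r.hom (congrArg ModuleCat.Hom.hom hsr)

theorem pureProjective_of_LP {P : ModuleCat.{u} R} (h : LP R P) : IsPureProjective P := by
  let M : CI R P → ModuleCat.{u} R := fun i => ModuleCat.of R (CS i)
  let c : (∐ M) ⟶ P := Sigma.desc (fun i => ModuleCat.ofHom i.2.2)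
  have hc : PureEpi c.hom := by
    intro S _ _ _ g
    obtain ⟨k, L, hL, ⟨e⟩⟩ := exists_fin_pres (R := R) S
    let i : CI R P := ⟨k, ⟨L, hL⟩, g ∘ₗ e.symm.toLinearMap⟩
    have hi : (Sigma.ι M i) ≫ c = ModuleCat.ofHom i.2.2 := Sigma.ι_desc _ _
    have hi' : ∀ x : CS i, c.hom ((Sigma.ι M i).hom x) = i.2.2 x := fun x =>
      LinearMap.congr_fun (congrArg ModuleCat.Hom.hom hi) x
    refine ⟨(Sigma.ι M i).hom ∘ₗ e.toLinearMap, ?_⟩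
    ext x
    rw [LinearMap.comp_apply, LinearMap.comp_apply]
    refine (hi' (e x)).trans ?_
    simp [i]
  obtain ⟨s, hs⟩ := h _ _ c.hom hc LinearMap.id
  refine ⟨CI R P, M, fun i => inferInstanceAs (Module.FinitePresentation R (CS i)),
    ModuleCat.ofHom s, c, ?_⟩
  ext x
  exact LinearMap.congr_fun hs x

variable [HasExt.{w} (ModuleCat.{u} R)]

theorem fpInjective_of_ext (K : Type u) [AddCommGroup K] [Module R K]
    (h : ∀ (k : ℕ) (L : Submodule R (Fin k → R)), L.FG → ∀ f : L →ₗ[R] K,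
      ∃ g : (Fin k → R) →ₗ[R] K, ∀ x : L, g x = f x) :
    IsFPInjective.{w} (ModuleCat.of R K) := by
  intro S hS
  refine subsingleton_of_forall_eq 0 ?_
  intro x
  obtain ⟨k, L, hL, ⟨e⟩⟩ := exists_fin_pres (R := R) S
  obtain ⟨h0, hSES⟩ := mkSES (C := S) L.subtype (e.symm.toLinearMap ∘ₗ L.mkQ) L.injective_subtype
    (e.symm.surjective.comp L.mkQ_surjective) (by
      intro y
      simp)
  have hpr : Projective (ModuleCat.of R (Fin k → R)) :=
    (IsProjective.iff_projective (Fin k → R)).1 inferInstance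
  obtain ⟨x1, hx1⟩ := Ext.contravariant_sequence_exact₃ hSES (ModuleCat.of R K) x
    (Ext.eq_zero_of_projective (P := ModuleCat.of R (Fin k → R)) _) (n₀ := 0) rfl
  obtain ⟨f, rfl⟩ := (Ext.mk₀_bijective _ _).2 x1
  obtain ⟨g, hg⟩ := h k L hL f.hom
  have hfg : f = ModuleCat.ofHom L.subtype ≫ ModuleCat.ofHom g := by
    ext y
    exact (hg y).symm
  rw [← hx1, hfg, ← Ext.mk₀_comp_mk₀]
  exact hSES.extClass_comp_assoc _

end Stmt16P

open Stmt16

/-- The dual of Xu's theorem: if the class of pure projective left `R`-modules is closed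
under extensions, then every FP-projective left `R`-module is pure projective. -/
theorem stmt16 {R : Type u} [Ring R] [HasExt.{w} (ModuleCat.{u} R)]
    (hext : ∀ S : ShortComplex (ModuleCat.{u} R), S.ShortExact →
      IsPureProjective S.X₁ → IsPureProjective S.X₃ → IsPureProjective S.X₂) :
    ∀ N : ModuleCat.{u} R, IsFPProjective.{w} N → IsPureProjective N := by
  intro N hN
  have hE : Stmt16P.ExtLP R := by
    intro A B C _ _ _ _ _ _ i p hi hp hex hA hC
    obtain ⟨h0, hS⟩ := Stmt16P.mkSES i p hi hp hex
    exact Stmt16P.LP_of_pureProjective (hext _ hS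
      (Stmt16P.pureProjective_of_LP (P := ModuleCat.of R A) hA)
      (Stmt16P.pureProjective_of_LP (P := ModuleCat.of R C) hC))
  obtain ⟨M, _, _, π, hM, hsurj, hK⟩ := Stmt16P.exists_special hE N
  have hinj : IsFPInjective.{w} (ModuleCat.of R (LinearMap.ker π)) := by
    apply Stmt16P.fpInjective_of_ext
    intro k L hL f
    obtain ⟨g, h1, h2⟩ := hK k L hL ((LinearMap.ker π).subtype ∘ₗ f) (fun x => (f x).2)
    exact ⟨g.codRestrict _ h1, fun x => Subtype.ext (h2 x)⟩
  obtain ⟨h0, hS⟩ := Stmt16P.mkSES (C := N) (LinearMap.ker π).subtype π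
    (LinearMap.ker π).injective_subtype hsurj (by
      intro y
      simp)
  have hsub := hN _ hinj
  obtain ⟨x2, hx2⟩ := Ext.covariant_sequence_exact₃ N hS (Ext.mk₀ (𝟙 N)) (zero_add 1)
    (Subsingleton.elim (α := Ext N (ModuleCat.of R (LinearMap.ker π)) 1) _ _)
  obtain ⟨s, rfl⟩ := (Ext.mk₀_bijective _ _).2 x2
  rw [Ext.mk₀_comp_mk₀] at hx2
  have hs := (Ext.mk₀_bijective _ _).1 hx2
  exact Stmt16P.pureProjective_of_LP (Stmt16P.LP_retract hM s.hom π
    (congrArg ModuleCat.Hom.hom hs))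
end

section
/- Let R be a ring, S the set of (representatives of isomorphism classes of) finitely presented left R-modules, and M any left R-module. Then there exists a short exact sequence 0 → M →^{g} G → W → 0 of left R-modules in which W is a direct sum of finitely presented modules and g is an S-ghost, i.e., Ext¹(S, g) : Ext¹(S, M) → Ext¹(S, G) is the zero map for every finitely presented module S. -/
open CategoryTheory Limits CategoryTheory.Abelian

universe w u

lemma mono_sigma_map_aux {R : Type u} [Ring R] {ι : Type u} (A B : ι → ModuleCat.{u} R)
    (f : ∀ i, A i ⟶ B i) [∀ i, Mono (f i)] : Mono (Limits.Sigma.map f) := by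
  have : ∀ j, Mono ((Discrete.natTrans (F := Discrete.functor A) (G := Discrete.functor B)
      (fun i => f i.as)).app j) := fun j => by
    dsimp; infer_instance
  have : Mono (Discrete.natTrans (F := Discrete.functor A) (G := Discrete.functor B)
      (fun i => f i.as)) := NatTrans.mono_of_mono_app _
  exact inferInstanceAs (Mono (colim.map (Discrete.natTrans (F := Discrete.functor A)
    (G := Discrete.functor B) (fun i => f i.as))))

lemma pushout_ses_aux {R : Type u} [Ring R] {ι : Type u} (M : ModuleCat.{u} R)
    (S : ι → ShortComplex (ModuleCat.{u} R)) (hS : ∀ i, (S i).ShortExact)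
    (φ : ∀ i, (S i).X₁ ⟶ M) :
    ∃ (G : ModuleCat.{u} R) (g : M ⟶ G) (p : G ⟶ ∐ fun i => (S i).X₃) (w : g ≫ p = 0),
      (ShortComplex.mk g p w).ShortExact ∧
      ∀ i, ∃ t : (S i).X₂ ⟶ G, φ i ≫ g = (S i).f ≫ t := by
  have hm : ∀ i, Mono (S i).f := fun i => (hS i).mono_f
  have he : ∀ i, Epi (S i).g := fun i => (hS i).epi_g
  have := mono_sigma_map_aux _ _ (fun i => (S i).f)
  let a : (∐ fun i => (S i).X₁) ⟶ ∐ fun i => (S i).X₂ := Limits.Sigma.map fun i => (S i).f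
  let b : (∐ fun i => (S i).X₂) ⟶ ∐ fun i => (S i).X₃ := Limits.Sigma.map fun i => (S i).g
  let d : (∐ fun i => (S i).X₁) ⟶ M := Limits.Sigma.desc φ
  have : Mono a := this
  have hab : a ≫ b = 0 := by
    apply Limits.Sigma.hom_ext
    intro i
    simp [a, b, (S i).zero_assoc]
  let p : pushout d a ⟶ ∐ fun i => (S i).X₃ := pushout.desc 0 b (by simp [hab])
  have w : pushout.inl d a ≫ p = 0 := pushout.inl_desc _ _ _
  have hp : pushout.inr d a ≫ p = b := pushout.inr_desc _ _ _
  have hb : Epi b := by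
    dsimp [b]; infer_instance
  have hpe : Epi p := by
    have : Epi (pushout.inr d a ≫ p) := by rw [hp]; exact hb
    exact epi_of_epi (pushout.inr d a) p
  refine ⟨pushout d a, pushout.inl d a, p, w, ?_, fun i => 
    ⟨Limits.Sigma.ι (fun i => (S i).X₂) i ≫ pushout.inr d a, ?_⟩⟩
  · have key : ∀ {T : ModuleCat.{u} R} (k : pushout d a ⟶ T), pushout.inl d a ≫ k = 0 →
        ∃ l, p ≫ l = k := by
      intro T k hk
      have h1 : ∀ i, (S i).f ≫ (Limits.Sigma.ι (fun i => (S i).X₂) i ≫ pushout.inr d a ≫ k) = 0 := by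
        intro i
        have : Limits.Sigma.ι (fun i => (S i).X₁) i ≫ a ≫ pushout.inr d a ≫ k = 0 := by
          rw [← pushout.condition_assoc, hk]; simp
        simpa [a] using this
      refine ⟨Limits.Sigma.desc fun i => (hS i).exact.desc _ (h1 i), ?_⟩
      apply pushout.hom_ext
      · rw [← Category.assoc, w, hk]; simp
      · rw [← Category.assoc, hp]
        apply Limits.Sigma.hom_ext
        intro i
        simp [b]
    have hex : (ShortComplex.mk _ p w).Exact := by
      apply ShortComplex.exact_of_g_is_cokernel
      exact CokernelCofork.IsColimit.ofπ _ _ (fun k hk => (key k hk).choose)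
        (fun k hk => (key k hk).choose_spec)
        (fun k hk m hm => by rw [← cancel_epi p, hm, (key k hk).choose_spec])
    exact { exact := hex
            mono_f := by dsimp; infer_instance
            epi_g := hpe }
  · have : Limits.Sigma.ι (fun i => (S i).X₁) i ≫ d ≫ pushout.inl d a =
      Limits.Sigma.ι (fun i => (S i).X₁) i ≫ a ≫ pushout.inr d a := by
      rw [pushout.condition]
    simpa [a, d] using this

lemma ses_aux {R : Type u} [Ring R] {P S : Type u} [AddCommGroup P] [Module R P]
    [AddCommGroup S] [Module R S] (K : Submodule R P) (f : P →ₗ[R] S)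
    (hf : Function.Surjective f) (hK : LinearMap.ker f = K) :
    ∃ w : ModuleCat.ofHom K.subtype ≫ ModuleCat.ofHom f = 0,
      (ShortComplex.mk (ModuleCat.ofHom K.subtype) (ModuleCat.ofHom f) w).ShortExact := by
  subst hK
  refine ⟨?_, ?_⟩
  · ext x
    exact x.2
  · refine { exact := ?_, mono_f := ?_, epi_g := ?_ }
    · rw [ShortComplex.moduleCat_exact_iff]
      intro x hx
      exact ⟨⟨x, hx⟩, rfl⟩
    · rw [ModuleCat.mono_iff_injective]
      exact Subtype.val_injective
    · rw [ModuleCat.epi_iff_surjective]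
      exact hf

/-- For every left `R`-module `M` there is a short exact sequence
`0 → M →^{g} G → W → 0` in which `W` is a direct sum of finitely presented modules and
`g` is an `S`-ghost for the class `S` of finitely presented modules, i.e.
`Ext¹(S, g) : Ext¹(S, M) → Ext¹(S, G)` is zero for every finitely presented `S`. -/
theorem stmt18 {R : Type u} [Ring R] [HasExt.{w} (ModuleCat.{u} R)]
    (M : ModuleCat.{u} R) :
    ∃ (G W : ModuleCat.{u} R) (g : M ⟶ G) (p : G ⟶ W) (w : g ≫ p = 0),
      (ShortComplex.mk g p w).ShortExact ∧
      (∃ (ι : Type u) (F : ι → ModuleCat.{u} R),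
        (∀ i, Module.FinitePresentation R (F i)) ∧ Nonempty (W ≅ ∐ F)) ∧
      (∀ S : ModuleCat.{u} R, Module.FinitePresentation R S →
        ∀ e : Ext.{w} S M 1, e.comp (Ext.mk₀ g) (add_zero 1) = 0) := by
  let ι : Type u := Σ (n : ℕ) (K : {K : Submodule R (Fin n → R) // K.FG}),
    (ModuleCat.of R K.1 ⟶ M)
  have hq : ∀ i : ι, _ := fun i => ses_aux i.2.1.1 i.2.1.1.mkQ
    (Submodule.mkQ_surjective _) (Submodule.ker_mkQ _)
  obtain ⟨G, g, p, w, hses, ht⟩ := pushout_ses_aux M (fun i : ι => ShortComplex.mk _ _ (hq i).choose)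
    (fun i => (hq i).choose_spec) (fun i => i.2.2)
  refine ⟨G, _, g, p, w, hses, ⟨ι, _, fun i => ?_, ⟨Iso.refl _⟩⟩, ?_⟩
  · exact Module.finitePresentation_of_free_of_surjective i.2.1.1.mkQ
      (Submodule.mkQ_surjective _) (by rw [Submodule.ker_mkQ]; exact i.2.1.2)
  · intro S hS e
    obtain ⟨n, K, eq, hK⟩ := Module.FinitePresentation.exists_fin R S
    obtain ⟨w', hs⟩ := ses_aux K (eq.symm.toLinearMap ∘ₗ K.mkQ)
      (eq.symm.surjective.comp (Submodule.mkQ_surjective _))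
      (by rw [LinearEquiv.ker_comp, Submodule.ker_mkQ])
    have hproj : Projective (ModuleCat.of R (Fin n → R)) :=
      ModuleCat.projective_of_free (Pi.basisFun R (Fin n))
    obtain ⟨x, hx⟩ := Ext.contravariant_sequence_exact₃ hs M e
      (Ext.eq_zero_of_projective _) (n₀ := 0) rfl
    obtain ⟨φ, rfl⟩ := (Ext.mk₀_bijective _ _).2 x
    obtain ⟨t, ht⟩ := ht ⟨n, ⟨K, hK⟩, φ⟩
    dsimp at ht
    subst hx
    rw [Ext.comp_assoc_of_third_deg_zero, Ext.mk₀_comp_mk₀, ht, ← Ext.mk₀_comp_mk₀]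
    exact hs.extClass_comp_assoc _
end
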